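/- arXiv:2308.16270 — 2 statements merged into one kernel-verified Lean document; each statement's English description precedes it below -/
import Mathlib

section
/- Assume the anticlustering condition DH holds. Then for every q ∈ (0,1), lim_{n→∞} (r_n w_n)^{−1} P({t(1) > q r_n} ∩ A_1) = (1−q)·θ and lim_{n→∞} (r_n w_n)^{−1} P({t(N_1) > q r_n} ∩ A_1) = (1−q)·θ, where θ = P(sup_{j≤−1} |Y_j| ≤ 1). -/
open MeasureTheory ProbabilityTheory Filter Topology Asymptotics
open scoped Classical

noncomputable section

namespace ClusterPaper

/-- `ℝ^d` with a norm. -/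
abbrev Vec (d : ℕ) : Type := EuclideanSpace ℝ (Fin d)

variable {d : ℕ} {Ω : Type*} [MeasureSpace Ω]

/-- Indices of exceedances over the level `1` of a sequence. -/
def excIdx (y : ℤ → Vec d) : Set ℤ := {j : ℤ | 1 < ‖y j‖}

/-- First exceedance index over level `1` (junk value if there is none). -/
def firstExc (y : ℤ → Vec d) : ℤ := sInf (excIdx y)

/-- Last exceedance index over level `1` (junk value if there is none). -/
def lastExc (y : ℤ → Vec d) : ℤ := sSup (excIdx y)

/-- Cluster length `L(y)` of a sequence: last exceedance index minus first one plus `1`,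
and `0` when there is no exceedance over `1`. -/
def clLen (y : ℤ → Vec d) : ℤ :=
  if (excIdx y).Nonempty then lastExc y - firstExc y + 1 else 0

/-- The scaled block: coordinates `1,…,r` are `xn⁻¹ • f (k+1), …, xn⁻¹ • f (k+r)`,
padded with zeros elsewhere (identification of finite vectors with elements of `ℓ₀`). -/
def blk (xn : ℝ) (r : ℕ) (k : ℤ) (f : ℤ → Vec d) : ℤ → Vec d :=
  fun j => if 1 ≤ j ∧ j ≤ (r : ℤ) then xn⁻¹ • f (k + j) else 0

/-- Exceedance indices over the threshold `xn` among positions `1,…,r`. -/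
def excB (xn : ℝ) (r : ℕ) (f : ℤ → Vec d) : Set ℤ :=
  {i : ℤ | 1 ≤ i ∧ i ≤ (r : ℤ) ∧ xn < ‖f i‖}

/-- The event `A₁` : some position in `1,…,r` exceeds the threshold. -/
def A1 (X : ℤ → Ω → Vec d) (xn : ℝ) (r : ℕ) : Set Ω :=
  {ω | (excB xn r (fun i => X i ω)).Nonempty}

/-- First exceedance time `t(1)` in the block `1,…,r`. -/
def tmin (X : ℤ → Ω → Vec d) (xn : ℝ) (r : ℕ) (ω : Ω) : ℤ :=
  sInf (excB xn r (fun i => X i ω))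

/-- Last exceedance time `t(N₁)` in the block `1,…,r`. -/
def tmax (X : ℤ → Ω → Vec d) (xn : ℝ) (r : ℕ) (ω : Ω) : ℤ :=
  sSup (excB xn r (fun i => X i ω))

/-- Cluster length `L₁ = t(N₁) - t(1) + 1` on `A₁`, and `0` off `A₁`. -/
def Len (X : ℤ → Ω → Vec d) (xn : ℝ) (r : ℕ) (ω : Ω) : ℤ :=
  if (excB xn r (fun i => X i ω)).Nonempty then tmax X xn r ω - tmin X xn r ω + 1 else 0

/-- `w_n = P(|X_0| > x_n)`. -/
def wseq (X : ℤ → Ω → Vec d) (x : ℕ → ℝ) (n : ℕ) : ℝ :=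
  (ℙ {ω | x n < ‖X 0 ω‖}).toReal

/-- The candidate extremal index `θ = P(sup_{j ≤ -1} |Y_j| ≤ 1)`. -/
def theta (Y : ℤ → Ω → Vec d) : ℝ :=
  (ℙ {ω | ∀ j : ℤ, j ≤ -1 → ‖Y j ω‖ ≤ 1}).toReal

/-- The cluster index `ν*(H) = E[H(Y) 1{sup_{j ≤ -1} |Y_j| ≤ 1}]`. -/
def nuStar (Y : ℤ → Ω → Vec d) (H : (ℤ → Vec d) → ℝ) : ℝ :=
  ∫ ω in {ω | ∀ j : ℤ, j ≤ -1 → ‖Y j ω‖ ≤ 1}, H (fun j => Y j ω) ∂ℙ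

/-- Stationarity of the time series. -/
def Stationary (X : ℤ → Ω → Vec d) : Prop :=
  ∀ k : ℤ, Measure.map (fun ω => (fun j : ℤ => X (j + k) ω)) ℙ =
    Measure.map (fun ω => (fun j : ℤ => X j ω)) ℙ

/-- `X` admits `Y` as its tail process: for all `i ≤ j` and all bounded continuous
functionals depending only on the coordinates `i,…,j`,
`E[H(x⁻¹ X) | |X_0| > x] → E[H(Y)]` as `x → ∞`. -/
def IsTailProcess (X Y : ℤ → Ω → Vec d) : Prop :=
  ∀ i j : ℤ, i ≤ j →
    ∀ H : (ℤ → Vec d) → ℝ, Continuous H → (∃ C, ∀ u, |H u| ≤ C) →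
      (∀ u v : ℤ → Vec d, (∀ k : ℤ, i ≤ k → k ≤ j → u k = v k) → H u = H v) →
      Tendsto (fun x : ℝ =>
          (∫ ω in {ω | x < ‖X 0 ω‖}, H (fun k => x⁻¹ • X k ω) ∂ℙ) /
            (ℙ {ω | x < ‖X 0 ω‖}).toReal)
        atTop (𝓝 (∫ ω, H (fun k => Y k ω) ∂ℙ))

/-- Condition `R(r_n, x_n)`. -/
def condR (X : ℤ → Ω → Vec d) (x : ℕ → ℝ) (r : ℕ → ℕ) : Prop :=
  Tendsto x atTop atTop ∧ Tendsto r atTop atTop ∧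
    Tendsto (fun n : ℕ => (n : ℝ) * wseq X x n) atTop atTop ∧
    Tendsto (fun n : ℕ => (r n : ℝ) / (n : ℝ)) atTop (𝓝 0) ∧
    Tendsto (fun n : ℕ => (r n : ℝ) * wseq X x n) atTop (𝓝 0)

/-- The anticlustering condition `DH(r_n, x_n)` of Davis and Hsing. -/
def condDH (X : ℤ → Ω → Vec d) (x : ℕ → ℝ) (r : ℕ → ℕ) : Prop :=
  ∀ s t : ℝ, 0 < s → 0 < t →
    Tendsto (fun ℓ : ℕ =>
      limsup (fun n : ℕ =>
        (ℙ {ω | (∃ j : ℤ, (ℓ : ℤ) ≤ |j| ∧ |j| ≤ (r n : ℤ) ∧ x n * s < ‖X j ω‖) ∧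
              x n * t < ‖X 0 ω‖}).toReal /
          (ℙ {ω | x n * t < ‖X 0 ω‖}).toReal) atTop)
      atTop (𝓝 0)

/-- The anticlustering condition `S^(γ)(r_n, x_n)`. -/
def condS (X : ℤ → Ω → Vec d) (x : ℕ → ℝ) (r : ℕ → ℕ) (γ : ℝ) : Prop :=
  ∀ s t : ℝ, 0 < s → 0 < t →
    Tendsto (fun ℓ : ℕ =>
      limsup (fun n : ℕ =>
        (wseq X x n)⁻¹ * ∑ i ∈ Finset.Icc ℓ (r n),
          (i : ℝ) ^ γ *
            (ℙ {ω | x n * s < ‖X 0 ω‖ ∧ x n * t < ‖X (i : ℤ) ω‖}).toReal) atTop)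
      atTop (𝓝 0)

/-- Membership in the class `H(γ)` of cluster functionals:
nonnegative, measurable, a.s. continuous w.r.t. the law of the tail process `Y`,
vanishing when all coordinates are `≤ 1` in norm, depending only on the coordinates
between the first and the last exceedance over `1`, and dominated by
`C · L(y)^γ` where `L` is the cluster length. -/
structure MemH (Y : ℤ → Ω → Vec d) (γ : ℝ) (H : (ℤ → Vec d) → ℝ) : Prop where
  meas : Measurable H
  nonneg : ∀ y, 0 ≤ H y
  contAE : ∀ᵐ ω ∂ℙ, ContinuousAt H (fun j => Y j ω)
  vanishes : ∀ y : ℤ → Vec d, (∀ j, ‖y j‖ ≤ 1) → H y = 0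
  window : ∀ y : ℤ → Vec d, (excIdx y).Nonempty →
      H y = H (fun j => if firstExc y ≤ j ∧ j ≤ lastExc y then y j else 0)
  growth : ∃ C : ℝ, ∀ y, H y ≤ C * (clLen y : ℝ) ^ γ

/-- The uniform integrability condition
`lim_ℓ limsup_n (r_n w_n)⁻¹ E[H(x_n⁻¹ X_{1,r_n}) 1{H(x_n⁻¹ X_{1,r_n}) > ℓ}] = 0`. -/
def condUI (X : ℤ → Ω → Vec d) (x : ℕ → ℝ) (r : ℕ → ℕ)
    (H : (ℤ → Vec d) → ℝ) : Prop :=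
  Tendsto (fun ℓ : ℕ =>
    limsup (fun n : ℕ =>
      (∫ ω in {ω' | (ℓ : ℝ) < H (blk (x n) (r n) 0 (fun i => X i ω'))},
          H (blk (x n) (r n) 0 (fun i => X i ω)) ∂ℙ) /
        ((r n : ℝ) * wseq X x n)) atTop)
    atTop (𝓝 0)

/-- The β-mixing coefficient between two σ-fields. -/
def betaMix (μ : Measure Ω) (F G : MeasurableSpace Ω) : ℝ :=
  sSup {b : ℝ | ∃ (N M : ℕ) (A : Fin N → Set Ω) (B : Fin M → Set Ω),
    (∀ i, MeasurableSet[F] (A i)) ∧ (∀ j, MeasurableSet[G] (B j)) ∧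
    (Pairwise fun i i' => Disjoint (A i) (A i')) ∧
    (Pairwise fun j j' => Disjoint (B j) (B j')) ∧
    (⋃ i, A i) = Set.univ ∧ (⋃ j, B j) = Set.univ ∧
    b = 2⁻¹ * ∑ i, ∑ j,
      |(μ (A i ∩ B j)).toReal - (μ (A i)).toReal * (μ (B j)).toReal|}

/-- σ-field generated by `X_i`, `i ≤ k`. -/
def sigmaLE (X : ℤ → Ω → Vec d) (k : ℤ) : MeasurableSpace Ω :=
  ⨆ i ∈ {i : ℤ | i ≤ k}, MeasurableSpace.comap (X i) inferInstance

/-- σ-field generated by `X_i`, `i ≥ k`. -/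
def sigmaGE (X : ℤ → Ω → Vec d) (k : ℤ) : MeasurableSpace Ω :=
  ⨆ i ∈ {i : ℤ | k ≤ i}, MeasurableSpace.comap (X i) inferInstance

/-- β-mixing coefficients `β_ℓ` of the series `X`. -/
def betaCoef (X : ℤ → Ω → Vec d) (ℓ : ℕ) : ℝ :=
  betaMix (ℙ : Measure Ω) (sigmaLE X 0) (sigmaGE X (ℓ : ℤ))

/-- `ℓ`-dependence of the series `X`. -/
def LDep (X : ℤ → Ω → Vec d) (ℓ : ℕ) : Prop :=
  ∀ k : ℤ, Indep (sigmaLE X k) (sigmaGE X (k + (ℓ : ℤ) + 1)) ℙ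

/-- The mixing condition `β(r_n, ℓ_n)`. -/
def condBeta (X : ℤ → Ω → Vec d) (r : ℕ → ℕ) : Prop :=
  ∃ ℓ : ℕ → ℕ, Tendsto ℓ atTop atTop ∧
    Tendsto (fun n : ℕ => (ℓ n : ℝ) / (r n : ℝ)) atTop (𝓝 0) ∧
    Tendsto (fun n : ℕ => ((n : ℝ) / (r n : ℝ)) * betaCoef X (ℓ n)) atTop (𝓝 0)

/-- The disjoint-blocks pseudo-estimator `ν̃*_{n}(H)`. -/
def estim (X : ℤ → Ω → Vec d) (x : ℕ → ℝ) (r : ℕ → ℕ)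
    (H : (ℤ → Vec d) → ℝ) (n : ℕ) (ω : Ω) : ℝ :=
  (∑ j ∈ Finset.range (n / r n),
      H (blk (x n) (r n) ((j : ℤ) * (r n : ℤ)) (fun i => X i ω))) /
    ((n : ℝ) * wseq X x n)

/-- The empirical cluster process `G̃_n(H)`. -/
def Gtil (X : ℤ → Ω → Vec d) (x : ℕ → ℝ) (r : ℕ → ℕ)
    (H : (ℤ → Vec d) → ℝ) (n : ℕ) (ω : Ω) : ℝ :=
  (∑ j ∈ Finset.range (n / r n),
      (H (blk (x n) (r n) ((j : ℤ) * (r n : ℤ)) (fun i => X i ω)) -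
        ∫ ω', H (blk (x n) (r n) ((j : ℤ) * (r n : ℤ)) (fun i => X i ω')) ∂ℙ)) /
    Real.sqrt ((n : ℝ) * wseq X x n)

/-- Convergence in distribution to a centered Gaussian law with variance `v`,
tested against bounded continuous functions. -/
def ConvToGaussian (S : ℕ → Ω → ℝ) (v : NNReal) : Prop :=
  ∀ φ : BoundedContinuousFunction ℝ ℝ,
    Tendsto (fun n => ∫ ω, φ (S n ω) ∂ℙ) atTop (𝓝 (∫ z, φ z ∂(gaussianReal 0 v)))

/-- The value `t_j(N_j)^γ · G(𝕏_j)` of the functional `H = T_max^γ · G` on the `j`-th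
block (`0`-indexed), equal to `0` if the block has no exceedance. -/
def jumpBlockVal (X : ℤ → Ω → Vec d) (x : ℕ → ℝ) (r : ℕ → ℕ) (γ : ℝ)
    (G : (ℤ → Vec d) → ℝ) (n j : ℕ) (ω : Ω) : ℝ :=
  if (excB (x n) (r n) (fun i => X ((j : ℤ) * (r n : ℤ) + i) ω)).Nonempty then
    (((sSup (excB (x n) (r n) (fun i => X ((j : ℤ) * (r n : ℤ) + i) ω)) : ℤ) : ℝ) ^ γ) *
      G (blk (x n) (r n) ((j : ℤ) * (r n : ℤ)) (fun i => X i ω))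
  else 0


/-- The law of a shifted trajectory of a stationary series is that of the trajectory. -/
lemma Stationary.measure_shift {X : ℤ → Ω → Vec d} (hstat : Stationary X)
    (hXm : ∀ j, Measurable (X j)) (k : ℤ) {S : Set (ℤ → Vec d)} (hS : MeasurableSet S) :
    (ℙ : Measure Ω) {ω | (fun j => X (j + k) ω) ∈ S} = ℙ {ω | (fun j => X j ω) ∈ S} := by
  have h1 := congrArg (fun m => m S) (hstat k)
  have hm1 : Measurable fun ω => (fun j : ℤ => X (j + k) ω) := by fun_prop
  have hm2 : Measurable fun ω => (fun j : ℤ => X j ω) := by fun_prop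
  simp only [Measure.map_apply hm1 hS, Measure.map_apply hm2 hS] at h1
  exact h1

lemma measurableSet_lt_norm (c : ℝ) (j : ℤ) : MeasurableSet {f : ℤ → Vec d | c < ‖f j‖} :=
  measurableSet_lt measurable_const (measurable_pi_apply j).norm

lemma measurableSet_forall_norm_le (c : ℝ) (a b : ℤ) :
    MeasurableSet {f : ℤ → Vec d | ∀ j, a ≤ j → j ≤ b → ‖f j‖ ≤ c} := by
  simp only [Set.ofPred_forall]
  exact MeasurableSet.iInter fun j => MeasurableSet.iInter fun _ => MeasurableSet.iInter fun _ =>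
    measurableSet_le (measurable_pi_apply j).norm measurable_const

/-- Probability that time `0` is an exceedance while the `i` preceding times are not. -/
def firstProb (X : ℤ → Ω → Vec d) (c : ℝ) (i : ℕ) : ℝ :=
  (ℙ {ω | c < ‖X 0 ω‖ ∧ ∀ j : ℤ, -(i : ℤ) ≤ j → j ≤ -1 → ‖X j ω‖ ≤ c}).toReal

/-- Decomposition of the exceedance event according to the position of the first exceedance. -/
lemma measure_A1_eq_sum [IsProbabilityMeasure (ℙ : Measure Ω)] {X : ℤ → Ω → Vec d}
    (hXm : ∀ j, Measurable (X j)) (hstat : Stationary X) (c : ℝ) (k : ℕ) :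
    (ℙ (A1 X c k)).toReal = ∑ i ∈ Finset.range k, firstProb X c i := by
  induction k with
  | zero =>
    have : A1 X c 0 = ∅ := by
      ext ω
      simp only [A1, excB, Set.mem_ofPred_eq, Set.mem_empty_iff_false, iff_false]
      rintro ⟨i, h1, h2, -⟩
      push_cast at h2
      omega
    simp [this]
  | succ k ih =>
    rw [Finset.sum_range_succ, ← ih]
    set B : Set Ω := {ω | c < ‖X (0 + ((k : ℤ) + 1)) ω‖ ∧
      ∀ j : ℤ, -(k : ℤ) ≤ j → j ≤ -1 → ‖X (j + ((k : ℤ) + 1)) ω‖ ≤ c} with hB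
    have hSm : MeasurableSet {f : ℤ → Vec d | c < ‖f 0‖ ∧
        ∀ j : ℤ, -(k : ℤ) ≤ j → j ≤ -1 → ‖f j‖ ≤ c} :=
      (measurableSet_lt_norm c 0).inter (measurableSet_forall_norm_le c _ _)
    have hBm : MeasurableSet B := by
      have hX' : Measurable fun ω => (fun j : ℤ => X (j + ((k : ℤ) + 1)) ω) := by fun_prop
      exact hX' hSm
    have hu : A1 X c (k + 1) = A1 X c k ∪ B := by
      ext ω
      simp only [A1, excB, hB, Set.mem_ofPred_eq, Set.mem_union, Set.Nonempty]
      push_cast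
      constructor
      · rintro ⟨i, h1, h2, h3⟩
        by_cases hA : ∃ x : ℤ, 1 ≤ x ∧ x ≤ (k : ℤ) ∧ c < ‖X x ω‖
        · exact Or.inl hA
        · push Not at hA
          refine Or.inr ⟨?_, fun j hj1 hj2 => hA _ (by omega) (by omega)⟩
          have : i = 0 + ((k : ℤ) + 1) := by
            by_contra hne
            exact absurd (hA i h1 (by omega)) (not_le.2 h3)
          rwa [← this]
      · rintro (⟨i, h1, h2, h3⟩ | ⟨h, -⟩)
        · exact ⟨i, h1, by omega, h3⟩
        · exact ⟨_, by omega, by omega, h⟩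
    have hd : Disjoint (A1 X c k) B := by
      rw [Set.disjoint_left]
      rintro ω ⟨i, h1, h2, h3⟩ ⟨-, h⟩
      have := h (i - (k + 1)) (by omega) (by omega)
      rw [sub_add_cancel] at this
      exact absurd this (not_le.2 h3)
    rw [hu, measure_union hd hBm, ENNReal.toReal_add (measure_ne_top _ _) (measure_ne_top _ _)]
    congr 2
    exact hstat.measure_shift hXm _ hSm

/-- Comparison of the exceedance probability of a block of length `k ≤ m` with
`k * firstProb X c ℓ`. -/
lemma abs_measure_A1_sub_le [IsProbabilityMeasure (ℙ : Measure Ω)] {X : ℤ → Ω → Vec d}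
    (hXm : ∀ j, Measurable (X j)) (hstat : Stationary X) (c : ℝ) {k m : ℕ} (hkm : k ≤ m)
    (ℓ : ℕ) :
    |(ℙ (A1 X c k)).toReal - k * firstProb X c ℓ| ≤
      k * (ℙ {ω | (∃ j : ℤ, (ℓ : ℤ) ≤ |j| ∧ |j| ≤ (m : ℤ) ∧ c < ‖X j ω‖) ∧
        c < ‖X 0 ω‖}).toReal + ℓ * (ℙ {ω | c < ‖X 0 ω‖}).toReal := by
  set D := (ℙ {ω | (∃ j : ℤ, (ℓ : ℤ) ≤ |j| ∧ |j| ≤ (m : ℤ) ∧ c < ‖X j ω‖) ∧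
        c < ‖X 0 ω‖}).toReal with hD
  set w := (ℙ {ω | c < ‖X 0 ω‖}).toReal with hw
  have hD0 : 0 ≤ D := ENNReal.toReal_nonneg
  have hw0 : 0 ≤ w := ENNReal.toReal_nonneg
  have hQ0 : ∀ i, 0 ≤ firstProb X c i := fun i => ENNReal.toReal_nonneg
  have hQw : ∀ i, firstProb X c i ≤ w := fun i =>
    ENNReal.toReal_mono (measure_ne_top _ _) (measure_mono fun ω h => h.1)
  have hanti : ∀ i j : ℕ, i ≤ j → firstProb X c j ≤ firstProb X c i := fun i j hij =>
    ENNReal.toReal_mono (measure_ne_top _ _)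
      (measure_mono fun ω h => ⟨h.1, fun a h1 h2 => h.2 a (by omega) h2⟩)
  have hlow : ∀ i : ℕ, i ≤ m → firstProb X c ℓ ≤ firstProb X c i + D := by
    intro i him
    rw [firstProb, firstProb, hD, ← ENNReal.toReal_add (measure_ne_top _ _) (measure_ne_top _ _)]
    refine ENNReal.toReal_mono (by finiteness) ((measure_mono ?_).trans (measure_union_le _ _))
    rintro ω ⟨h0, h⟩
    by_cases hi : ∀ j : ℤ, -(i : ℤ) ≤ j → j ≤ -1 → ‖X j ω‖ ≤ c
    · exact Or.inl ⟨h0, hi⟩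
    · push Not at hi
      obtain ⟨j, h1, h2, h3⟩ := hi
      have hj : |j| = -j := abs_of_nonpos (by omega)
      refine Or.inr ⟨⟨j, ?_, by omega, h3⟩, h0⟩
      by_contra hlt
      exact absurd (h j (by omega) h2) (not_le.2 h3)
  have hterm : ∀ i ∈ Finset.range k,
      |firstProb X c i - firstProb X c ℓ| ≤ D + if i < ℓ then w else 0 := by
    intro i hi
    have him : i ≤ m := (Finset.mem_range.1 hi).le.trans hkm
    have h1 := hlow i him
    rw [abs_le]
    split_ifs with h
    · constructor <;> linarith [hQ0 ℓ, hQw i]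
    · constructor <;> linarith [hanti ℓ i (by omega)]
  have hcard : ∑ i ∈ Finset.range k, (if i < ℓ then w else 0) ≤ ℓ * w := by
    rw [← Finset.sum_filter, Finset.sum_const, nsmul_eq_mul]
    refine mul_le_mul_of_nonneg_right ?_ hw0
    have : ({i ∈ Finset.range k | i < ℓ} : Finset ℕ) ⊆ Finset.range ℓ := fun i hi =>
      Finset.mem_range.2 (Finset.mem_filter.1 hi).2
    exact_mod_cast (Finset.card_le_card this).trans (Finset.card_range ℓ).le
  have hsum : (ℙ (A1 X c k)).toReal - k * firstProb X c ℓ =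
      ∑ i ∈ Finset.range k, (firstProb X c i - firstProb X c ℓ) := by
    rw [measure_A1_eq_sum hXm hstat, Finset.sum_sub_distrib]
    simp
  rw [hsum]
  calc _ ≤ ∑ i ∈ Finset.range k, |firstProb X c i - firstProb X c ℓ| :=
        Finset.abs_sum_le_sum_abs _ _
    _ ≤ ∑ i ∈ Finset.range k, (D + if i < ℓ then w else 0) := Finset.sum_le_sum hterm
    _ ≤ _ := by
      rw [Finset.sum_add_distrib]
      simpa using hcard

/-- Convergence of conditional probabilities on continuity sets of the tail process. -/
lemma IsTailProcess.tendsto_measure [IsProbabilityMeasure (ℙ : Measure Ω)]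
    {X Y : ℤ → Ω → Vec d}
    (hXm : ∀ j, Measurable (X j)) (hYm : ∀ j, Measurable (Y j)) (htail : IsTailProcess X Y)
    (hpos : ∀ c : ℝ, 0 < (ℙ {ω | c < ‖X 0 ω‖}).toReal)
    {T : (ℤ → Vec d) → ℝ} (hT : Continuous T) {i j : ℤ} (hij : i ≤ j)
    (hloc : ∀ f g : ℤ → Vec d, (∀ k, i ≤ k → k ≤ j → f k = g k) → T f = T g)
    {S : Set ℝ} (hS : MeasurableSet S)
    (hfr : (ℙ : Measure Ω) {ω | T (fun k => Y k ω) ∈ frontier S} = 0) :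
    Tendsto (fun c : ℝ => (ℙ {ω | c < ‖X 0 ω‖ ∧ T (fun k => c⁻¹ • X k ω) ∈ S}).toReal /
        (ℙ {ω | c < ‖X 0 ω‖}).toReal) atTop
      (𝓝 (ℙ {ω | T (fun k => Y k ω) ∈ S}).toReal) := by
  have hms : ∀ c : ℝ, MeasurableSet {ω | c < ‖X 0 ω‖} := fun c =>
    measurableSet_lt measurable_const (hXm 0).norm
  have hTX : ∀ c : ℝ, Measurable fun ω => T (fun k => c⁻¹ • X k ω) := fun c =>
    hT.measurable.comp (measurable_pi_lambda _ fun k => (hXm k).fun_const_smul c⁻¹)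
  have hTY : Measurable fun ω => T (fun k => Y k ω) :=
    hT.measurable.comp (measurable_pi_lambda _ fun k => hYm k)
  have hp : ∀ c : ℝ, IsProbabilityMeasure ((ℙ : Measure Ω)[|{ω | c < ‖X 0 ω‖}]) := fun c =>
    cond_isProbabilityMeasure fun h => by simpa [h] using hpos c
  let ν : ℝ → ProbabilityMeasure ℝ := fun c =>
    ⟨((ℙ : Measure Ω)[|{ω | c < ‖X 0 ω‖}]).map (fun ω => T (fun k => c⁻¹ • X k ω)),
      Measure.isProbabilityMeasure_map (hTX c).aemeasurable⟩
  let ν' : ProbabilityMeasure ℝ :=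
    ⟨(ℙ : Measure Ω).map (fun ω => T (fun k => Y k ω)),
      Measure.isProbabilityMeasure_map hTY.aemeasurable⟩
  have hlim : Tendsto ν atTop (𝓝 ν') := by
    rw [ProbabilityMeasure.tendsto_iff_forall_integral_tendsto]
    intro φ
    have h := htail i j hij (fun f => φ (T f)) (φ.continuous.comp hT)
      ⟨‖φ‖, fun f => φ.norm_coe_le_norm _⟩ (fun f g hfg => by rw [hloc f g hfg])
    have e : ∫ t, φ t ∂(ν' : Measure ℝ) = ∫ ω, φ (T (fun k => Y k ω)) ∂ℙ :=
      integral_map hTY.aemeasurable φ.continuous.aestronglyMeasurable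
    rw [e]
    refine h.congr fun c => ?_
    have e' : ∫ t, φ t ∂(ν c : Measure ℝ) =
        ∫ ω, φ (T (fun k => c⁻¹ • X k ω)) ∂((ℙ : Measure Ω)[|{ω | c < ‖X 0 ω‖}]) :=
      integral_map (hTX c).aemeasurable φ.continuous.aestronglyMeasurable
    rw [e', ProbabilityTheory.cond, integral_smul_measure, ENNReal.toReal_inv, smul_eq_mul,
      div_eq_inv_mul]
  have hfr' : (ν' : Measure ℝ) (frontier S) = 0 := by
    rw [← hfr]
    exact Measure.map_apply hTY isClosed_frontier.measurableSet
  have key := (ENNReal.tendsto_toReal (measure_ne_top _ _)).comp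
    (ProbabilityMeasure.tendsto_measure_of_null_frontier_of_tendsto' hlim hfr')
  have e : (ν' : Measure ℝ) S = ℙ {ω | T (fun k => Y k ω) ∈ S} := Measure.map_apply hTY hS
  rw [e] at key
  refine key.congr fun c => ?_
  have e' : (ν c : Measure ℝ) S = (ℙ : Measure Ω)[|{ω | c < ‖X 0 ω‖}]
      {ω | T (fun k => c⁻¹ • X k ω) ∈ S} := Measure.map_apply (hTX c) hS
  simp only [Function.comp_apply]
  rw [e', cond_apply (hms c), ENNReal.toReal_mul, ENNReal.toReal_inv, div_eq_inv_mul]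
  rfl

lemma exists_mem_Ioo_measure_eq_zero [IsProbabilityMeasure (ℙ : Measure Ω)] {g : Ω → ℝ}
    (hg : Measurable g) {a b : ℝ} (hab : a < b) :
    ∃ u ∈ Set.Ioo a b, (ℙ : Measure Ω) {ω | g ω = u} = 0 := by
  by_contra! hne
  have hc := Measure.countable_meas_level_set_pos (μ := (ℙ : Measure Ω)) hg
  have := Cardinal.Real.Ioo_countable_iff.1 (hc.mono fun u hu => pos_iff_ne_zero.2 (hne u hu))
  exact absurd hab this.not_gt

/-- Near `u = 1`, the tail function of `‖X 0‖` loses at most half of its mass. -/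
lemma IsTailProcess.exists_half_le [IsProbabilityMeasure (ℙ : Measure Ω)] {X Y : ℤ → Ω → Vec d}
    (hXm : ∀ j, Measurable (X j)) (hYm : ∀ j, Measurable (Y j)) (htail : IsTailProcess X Y)
    (hY0 : ∀ᵐ ω ∂ℙ, 1 < ‖Y 0 ω‖)
    (hpos : ∀ c : ℝ, 0 < (ℙ {ω | c < ‖X 0 ω‖}).toReal) :
    ∃ u₀ : ℝ, 1 < u₀ ∧ ∀ u, u ≤ u₀ → ∀ᶠ c : ℝ in atTop,
      (ℙ {ω | c < ‖X 0 ω‖}).toReal ≤ 2 * (ℙ {ω | u * c < ‖X 0 ω‖}).toReal := by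
  obtain ⟨k, hk⟩ : ∃ k : ℕ, 1 / 2 < (ℙ {ω | 1 + 1 / ((k : ℝ) + 1) < ‖Y 0 ω‖}).toReal := by
    have hmono : Monotone fun k : ℕ => {ω | 1 + 1 / ((k : ℝ) + 1) < ‖Y 0 ω‖} := by
      intro a b hab ω hω
      change 1 + 1 / ((a : ℝ) + 1) < ‖Y 0 ω‖ at hω
      change 1 + 1 / ((b : ℝ) + 1) < ‖Y 0 ω‖
      refine lt_of_le_of_lt ?_ hω
      gcongr
    have h := tendsto_measure_iUnion_atTop (μ := (ℙ : Measure Ω)) hmono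
    have hU : (ℙ : Measure Ω) (⋃ k : ℕ, {ω | 1 + 1 / ((k : ℝ) + 1) < ‖Y 0 ω‖}) = 1 := by
      rw [← prob_compl_eq_zero_iff₀]
      · refine measure_mono_null ?_ (ae_iff.1 hY0)
        intro ω hω h1
        obtain ⟨k, hk⟩ := exists_nat_one_div_lt (sub_pos.2 h1)
        exact hω (Set.mem_iUnion.2 ⟨k, by
          change 1 + 1 / ((k : ℝ) + 1) < ‖Y 0 ω‖
          linarith⟩)
      · exact (MeasurableSet.iUnion fun k =>
          measurableSet_lt measurable_const (hYm 0).norm).nullMeasurableSet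
    rw [hU] at h
    have h' := (ENNReal.tendsto_toReal ENNReal.one_ne_top).comp h
    exact (h'.eventually_const_lt (by norm_num)).exists
  have hk1 : (1 : ℝ) < 1 + 1 / ((k : ℝ) + 1) := lt_add_of_pos_right _ (by positivity)
  obtain ⟨u₀, ⟨h1, h2⟩, h3⟩ := exists_mem_Ioo_measure_eq_zero (hYm 0).norm hk1
  refine ⟨u₀, h1, fun u hu => ?_⟩
  have ht := htail.tendsto_measure hXm hYm hpos (T := fun f => ‖f 0‖) (by fun_prop)
    (le_refl (0 : ℤ)) (fun f g h => by rw [h 0 le_rfl le_rfl]) (S := Set.Ioi u₀)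
    measurableSet_Ioi (by rw [frontier_Ioi]; exact h3)
  have hlt : 1 / 2 < (ℙ {ω | ‖Y 0 ω‖ ∈ Set.Ioi u₀}).toReal :=
    hk.trans_le (ENNReal.toReal_mono (measure_ne_top _ _)
      (measure_mono fun ω hω => h2.trans hω))
  filter_upwards [ht.eventually_const_lt hlt, eventually_gt_atTop 0] with c hc hc0
  rw [lt_div_iff₀ (hpos c)] at hc
  have hle : (ℙ {ω | c < ‖X 0 ω‖ ∧ ‖c⁻¹ • X 0 ω‖ ∈ Set.Ioi u₀}).toReal ≤
      (ℙ {ω | u * c < ‖X 0 ω‖}).toReal := by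
    refine ENNReal.toReal_mono (measure_ne_top _ _) (measure_mono fun ω hω => ?_)
    have h4 : u₀ < ‖c⁻¹ • X 0 ω‖ := hω.2
    rw [norm_smul, Real.norm_of_nonneg (by positivity), inv_mul_eq_div, lt_div_iff₀ hc0] at h4
    exact (mul_le_mul_of_nonneg_right hu hc0.le).trans_lt h4
  linarith

lemma IsTailProcess.integral_le_two_mul [IsProbabilityMeasure (ℙ : Measure Ω)]
    {X Y : ℤ → Ω → Vec d} (hXm : ∀ j, Measurable (X j)) (htail : IsTailProcess X Y)
    (hpos : ∀ c : ℝ, 0 < (ℙ {ω | c < ‖X 0 ω‖}).toReal) {u : ℝ} (hu1 : 1 < u)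
    (hu : ∀ᶠ c : ℝ in atTop,
      (ℙ {ω | c < ‖X 0 ω‖}).toReal ≤ 2 * (ℙ {ω | u * c < ‖X 0 ω‖}).toReal)
    {φ : ℝ → ℝ} (hφ : Continuous φ) (hφ0 : ∀ t, 0 ≤ φ t) (hφ1 : ∀ t, φ t ≤ 1) (j : ℤ) :
    ∫ ω, φ ‖Y j ω‖ ∂ℙ ≤ 2 * ∫ ω, φ ‖u⁻¹ • Y j ω‖ ∂ℙ := by
  have hu0 : 0 < u := one_pos.trans hu1
  have hb : ∀ t, |φ t| ≤ 1 := fun t => by rw [abs_of_nonneg (hφ0 t)]; exact hφ1 t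
  have ht1 := (htail j j le_rfl (fun f => φ ‖f j‖) (by fun_prop) ⟨1, fun f => hb _⟩
    (fun f g h => by simp only [h j le_rfl le_rfl])).comp (tendsto_id.const_mul_atTop hu0)
  have ht2 := (htail j j le_rfl (fun f => φ ‖u⁻¹ • f j‖) (by fun_prop) ⟨1, fun f => hb _⟩
    (fun f g h => by simp only [h j le_rfl le_rfl])).const_mul 2
  refine le_of_tendsto_of_tendsto ht1 ht2 ?_
  filter_upwards [hu, eventually_gt_atTop 0] with c hc hc0
  simp only [Function.comp_apply, id]
  have hsub : {ω | u * c < ‖X 0 ω‖} ⊆ {ω | c < ‖X 0 ω‖} := fun ω hω =>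
    lt_of_le_of_lt (le_mul_of_one_le_left hc0.le hu1.le) hω
  have hmeas : Measurable fun ω => φ ‖u⁻¹ • c⁻¹ • X j ω‖ :=
    hφ.measurable.comp (((hXm j).fun_const_smul c⁻¹).fun_const_smul u⁻¹).norm
  have hint : Integrable (fun ω => φ ‖u⁻¹ • c⁻¹ • X j ω‖) (ℙ : Measure Ω) :=
    Integrable.of_bound hmeas.aestronglyMeasurable 1 (ae_of_all _ fun ω => hb _)
  have hle : ∫ ω in {ω | u * c < ‖X 0 ω‖}, φ ‖(u * c)⁻¹ • X j ω‖ ∂ℙ ≤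
      ∫ ω in {ω | c < ‖X 0 ω‖}, φ ‖u⁻¹ • c⁻¹ • X j ω‖ ∂ℙ := by
    simp only [mul_inv, mul_smul]
    exact setIntegral_mono_set hint.integrableOn (ae_of_all _ fun ω => hφ0 _)
      (ae_of_all _ hsub)
  have hI0 : 0 ≤ ∫ ω in {ω | c < ‖X 0 ω‖}, φ ‖u⁻¹ • c⁻¹ • X j ω‖ ∂ℙ :=
    integral_nonneg fun ω => hφ0 _
  rw [mul_div_assoc', div_le_div_iff₀ (hpos _) (hpos _)]
  calc _ ≤ (∫ ω in {ω | c < ‖X 0 ω‖}, φ ‖u⁻¹ • c⁻¹ • X j ω‖ ∂ℙ) *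
        (2 * (ℙ {ω | u * c < ‖X 0 ω‖}).toReal) :=
        mul_le_mul hle hc ENNReal.toReal_nonneg hI0
    _ = _ := by ring

/-- The norms of the tail process have no atom at `1`. -/
lemma IsTailProcess.measure_norm_eq_one [IsProbabilityMeasure (ℙ : Measure Ω)]
    {X Y : ℤ → Ω → Vec d}
    (hXm : ∀ j, Measurable (X j)) (hYm : ∀ j, Measurable (Y j)) (htail : IsTailProcess X Y)
    (hY0 : ∀ᵐ ω ∂ℙ, 1 < ‖Y 0 ω‖)
    (hpos : ∀ c : ℝ, 0 < (ℙ {ω | c < ‖X 0 ω‖}).toReal) (j : ℤ) :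
    (ℙ : Measure Ω) {ω | ‖Y j ω‖ = 1} = 0 := by
  obtain ⟨u₀, hu₀, hhalf⟩ := htail.exists_half_le hXm hYm hY0 hpos
  obtain ⟨u, ⟨hu1, huu⟩, hu⟩ := exists_mem_Ioo_measure_eq_zero (hYm j).norm hu₀
  have hu0 : 0 < u := one_pos.trans hu1
  let φ : ℕ → ℝ → ℝ := fun k t => max 0 (1 - k * |t - 1|)
  have hφc : ∀ k, Continuous (φ k) := fun k => by fun_prop
  have hφ0 : ∀ k t, 0 ≤ φ k t := fun k t => le_max_left _ _
  have hφ1 : ∀ k t, φ k t ≤ 1 := fun k t => max_le zero_le_one (by simp; positivity)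
  have hlim : Tendsto (fun k => ∫ ω, φ k ‖u⁻¹ • Y j ω‖ ∂(ℙ : Measure Ω)) atTop
      (𝓝 (∫ _, (0 : ℝ) ∂(ℙ : Measure Ω))) := by
    refine tendsto_integral_of_dominated_convergence (fun _ => 1)
      (fun k => ((hφc k).measurable.comp ((hYm j).fun_const_smul u⁻¹).norm).aestronglyMeasurable)
      (integrable_const _) (fun k => ae_of_all _ fun ω => ?_) ?_
    · rw [Real.norm_of_nonneg (hφ0 _ _)]; exact hφ1 _ _
    · have hne : ∀ᵐ ω ∂(ℙ : Measure Ω), ‖Y j ω‖ ≠ u := by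
        rw [ae_iff]; simpa using hu
      filter_upwards [hne] with ω hω
      have hω' : 0 < |‖u⁻¹ • Y j ω‖ - 1| := by
        rw [abs_pos, sub_ne_zero, norm_smul, Real.norm_of_nonneg (by positivity),
          inv_mul_eq_div, Ne, div_eq_one_iff_eq hu0.ne']
        exact hω
      refine tendsto_const_nhds.congr' ?_
      have h1 : Tendsto (fun k : ℕ => (k : ℝ) * |‖u⁻¹ • Y j ω‖ - 1|) atTop atTop :=
        tendsto_natCast_atTop_atTop.atTop_mul_const hω'
      filter_upwards [h1.eventually_ge_atTop 1] with k hk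
      exact (max_eq_left (by linarith)).symm
  have hms : MeasurableSet {ω | ‖Y j ω‖ = 1} :=
    measurableSet_eq_fun (hYm j).norm measurable_const
  have hlow : ∀ k, (ℙ {ω | ‖Y j ω‖ = 1}).toReal ≤ 2 * ∫ ω, φ k ‖u⁻¹ • Y j ω‖ ∂ℙ := by
    intro k
    refine le_trans ?_
      (htail.integral_le_two_mul hXm hpos hu1 (hhalf u huu.le) (hφc k) (hφ0 k) (hφ1 k) j)
    calc (ℙ {ω | ‖Y j ω‖ = 1}).toReal
        = ∫ ω, {ω | ‖Y j ω‖ = 1}.indicator (fun _ => (1 : ℝ)) ω ∂ℙ := by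
          rw [integral_indicator_const _ hms]; simp [Measure.real]
      _ ≤ _ := by
          refine integral_mono_of_nonneg
            (ae_of_all _ fun ω => Set.indicator_nonneg (fun _ _ => zero_le_one) _) ?_
            (ae_of_all _ fun ω => Set.indicator_le' (g := fun ω => φ k ‖Y j ω‖)
              (fun ω hω => ?_) (fun ω _ => hφ0 _ _) ω)
          · refine Integrable.of_bound
              ((hφc k).measurable.comp (hYm j).norm).aestronglyMeasurable 1
              (ae_of_all _ fun ω => ?_)
            rw [Real.norm_of_nonneg (hφ0 _ _)]; exact hφ1 _ _
          · have hω' : ‖Y j ω‖ = 1 := hω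
            simp [φ, hω']
  have h0 := ge_of_tendsto' (hlim.const_mul 2) hlow
  simp only [integral_zero, mul_zero] at h0
  have := le_antisymm h0 ENNReal.toReal_nonneg
  exact ((ENNReal.toReal_eq_zero_iff _).1 this).resolve_right (measure_ne_top _ _)

lemma IsTailProcess.tendsto_firstProb [IsProbabilityMeasure (ℙ : Measure Ω)]
    {X Y : ℤ → Ω → Vec d}
    (hXm : ∀ j, Measurable (X j)) (hYm : ∀ j, Measurable (Y j)) (htail : IsTailProcess X Y)
    (hY0 : ∀ᵐ ω ∂ℙ, 1 < ‖Y 0 ω‖)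
    (hpos : ∀ c : ℝ, 0 < (ℙ {ω | c < ‖X 0 ω‖}).toReal) (ℓ : ℕ) :
    Tendsto (fun c => firstProb X c ℓ / (ℙ {ω | c < ‖X 0 ω‖}).toReal) atTop
      (𝓝 (ℙ {ω | ∀ j : ℤ, -(ℓ : ℤ) ≤ j → j ≤ -1 → ‖Y j ω‖ ≤ 1}).toReal) := by
  let T : (ℤ → Vec d) → ℝ := fun f =>
    ((Finset.Icc (-(ℓ : ℤ)) (-1)).sup fun j => ‖f j‖₊ : NNReal)
  have hT : Continuous T := NNReal.continuous_coe.comp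
    (Continuous.finset_sup_apply fun j _ => (continuous_apply j).nnnorm)
  have hTle : ∀ f : ℤ → Vec d, T f ∈ Set.Iic 1 ↔
      ∀ j : ℤ, -(ℓ : ℤ) ≤ j → j ≤ -1 → ‖f j‖ ≤ 1 := by
    intro f
    simp only [T, Set.mem_Iic, NNReal.coe_le_one, Finset.sup_le_iff, Finset.mem_Icc, and_imp]
    rfl
  have hloc : ∀ f g : ℤ → Vec d, (∀ k, -(ℓ : ℤ) ≤ k → k ≤ 0 → f k = g k) → T f = T g := by
    intro f g h
    simp only [T, NNReal.coe_inj]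
    refine Finset.sup_congr rfl fun j hj => ?_
    rw [Finset.mem_Icc] at hj
    rw [h j hj.1 (by omega)]
  have hfr : (ℙ : Measure Ω) {ω | T (fun k => Y k ω) ∈ frontier (Set.Iic 1)} = 0 := by
    rw [frontier_Iic]
    refine measure_mono_null (t := ⋃ j : ℤ, {ω | ‖Y j ω‖ = 1}) ?_
      (measure_iUnion_null fun j => htail.measure_norm_eq_one hXm hYm hY0 hpos j)
    intro ω hω
    have h1 : ((Finset.Icc (-(ℓ : ℤ)) (-1)).sup fun j => ‖Y j ω‖₊) = 1 :=
      NNReal.coe_eq_one.1 hω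
    have hne : (Finset.Icc (-(ℓ : ℤ)) (-1)).Nonempty := by
      by_contra h
      rw [Finset.not_nonempty_iff_eq_empty] at h
      simp [h] at h1
    obtain ⟨j, -, hj⟩ := Finset.exists_mem_eq_sup _ hne fun j => ‖Y j ω‖₊
    refine Set.mem_iUnion.2 ⟨j, ?_⟩
    change ((‖Y j ω‖₊ : NNReal) : ℝ) = 1
    rw [← hj, h1, NNReal.coe_one]
  have h := htail.tendsto_measure hXm hYm hpos hT (show -(ℓ : ℤ) ≤ 0 by omega) hloc
    measurableSet_Iic hfr
  simp only [hTle] at h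
  refine h.congr' ?_
  filter_upwards [eventually_gt_atTop 0] with c hc
  simp only [firstProb, norm_smul, norm_inv, Real.norm_of_nonneg hc.le, inv_mul_le_iff₀ hc,
    mul_one]

lemma tendsto_measure_forall_le_theta [IsProbabilityMeasure (ℙ : Measure Ω)]
    {Y : ℤ → Ω → Vec d} (hYm : ∀ j, Measurable (Y j)) :
    Tendsto (fun ℓ : ℕ => (ℙ {ω | ∀ j : ℤ, -(ℓ : ℤ) ≤ j → j ≤ -1 → ‖Y j ω‖ ≤ 1}).toReal) atTop
      (𝓝 (theta Y)) := by
  have hY : Measurable fun ω => (fun j : ℤ => Y j ω) := by fun_prop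
  have h := tendsto_measure_iInter_atTop (μ := (ℙ : Measure Ω))
    (s := fun ℓ : ℕ => {ω | ∀ j : ℤ, -(ℓ : ℤ) ≤ j → j ≤ -1 → ‖Y j ω‖ ≤ 1})
    (fun ℓ => (hY (measurableSet_forall_norm_le 1 (-(ℓ : ℤ)) (-1))).nullMeasurableSet)
    (fun a b hab ω hω j h1 h2 => hω j (by omega) h2) ⟨0, measure_ne_top _ _⟩
  have e : (⋂ ℓ : ℕ, {ω | ∀ j : ℤ, -(ℓ : ℤ) ≤ j → j ≤ -1 → ‖Y j ω‖ ≤ 1}) =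
      {ω | ∀ j : ℤ, j ≤ -1 → ‖Y j ω‖ ≤ 1} := by
    ext ω
    simp only [Set.mem_iInter, Set.mem_ofPred_eq]
    exact ⟨fun h j hj => h j.natAbs j (by omega) hj, fun h ℓ j _ hj => h j hj⟩
  rw [e] at h
  exact (ENNReal.tendsto_toReal (measure_ne_top _ _)).comp h

lemma condR.tail_pos [IsProbabilityMeasure (ℙ : Measure Ω)] {X : ℤ → Ω → Vec d} {x : ℕ → ℝ}
    {r : ℕ → ℕ} (hR : condR X x r) (c : ℝ) : 0 < (ℙ {ω | c < ‖X 0 ω‖}).toReal := by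
  obtain ⟨n, hn1, hn2⟩ := ((hR.1.eventually_ge_atTop c).and
    (hR.2.2.1.eventually_gt_atTop 0)).exists
  have hw : 0 < wseq X x n := pos_of_mul_pos_right hn2 n.cast_nonneg
  exact hw.trans_le (ENNReal.toReal_mono (measure_ne_top _ _)
    (measure_mono fun ω hω => lt_of_le_of_lt hn1 hω))

/-- Blocks of length `k n ≤ r n` have asymptotic exceedance probability `k n * w n * θ`. -/
lemma tendsto_measure_A1_div [IsProbabilityMeasure (ℙ : Measure Ω)] {X Y : ℤ → Ω → Vec d}
    (hXm : ∀ j, Measurable (X j)) (hYm : ∀ j, Measurable (Y j))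
    (hstat : Stationary X) (htail : IsTailProcess X Y)
    (hY0 : ∀ᵐ ω ∂ℙ, 1 < ‖Y 0 ω‖) {x : ℕ → ℝ} {r : ℕ → ℕ} (hR : condR X x r)
    (hDH : condDH X x r) {k : ℕ → ℕ} (hk : Tendsto k atTop atTop) (hkr : ∀ n, k n ≤ r n) :
    Tendsto (fun n => (ℙ (A1 X (x n) (k n))).toReal / (k n * wseq X x n)) atTop
      (𝓝 (theta Y)) := by
  have hpos := hR.tail_pos
  have hD := hDH 1 1 one_pos one_pos
  simp only [mul_one] at hD
  rw [Metric.tendsto_nhds]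
  intro ε hε
  obtain ⟨ℓ, hℓ1, hℓ2⟩ := ((hD.eventually_lt_const (show 0 < ε / 4 by positivity)).and
    (Metric.tendsto_nhds.1 (tendsto_measure_forall_le_theta hYm) (ε / 4) (by positivity))).exists
  have hDn := eventually_lt_of_limsup_lt hℓ1 (isBoundedUnder_of ⟨1, fun n =>
    div_le_one_of_le₀ (ENNReal.toReal_mono (measure_ne_top _ _) (measure_mono fun ω h => h.2))
      ENNReal.toReal_nonneg⟩)
  have hp := Metric.tendsto_nhds.1
    ((htail.tendsto_firstProb hXm hYm hY0 hpos ℓ).comp hR.1) (ε / 4) (by positivity)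
  have hℓk : ∀ᶠ n in atTop, (ℓ : ℝ) / k n < ε / 4 :=
    ((tendsto_natCast_atTop_atTop.comp hk).const_div_atTop (ℓ : ℝ)).eventually_lt_const
      (by positivity)
  filter_upwards [hDn, hp, hℓk, hk.eventually_ge_atTop 1] with n h1 h2 h3 h4
  have hw : 0 < wseq X x n := hpos (x n)
  have hk0 : (0 : ℝ) < k n := by exact_mod_cast h4
  have hmain := abs_measure_A1_sub_le hXm hstat (x n) (hkr n) ℓ
  have hdiv : |(ℙ (A1 X (x n) (k n))).toReal / (k n * wseq X x n) -
      firstProb X (x n) ℓ / wseq X x n| ≤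
      (ℙ {ω | (∃ j : ℤ, (ℓ : ℤ) ≤ |j| ∧ |j| ≤ (r n : ℤ) ∧ x n < ‖X j ω‖) ∧
        x n < ‖X 0 ω‖}).toReal / wseq X x n + ℓ / k n := by
    have e1 : (ℙ (A1 X (x n) (k n))).toReal / (k n * wseq X x n) -
        firstProb X (x n) ℓ / wseq X x n =
        ((ℙ (A1 X (x n) (k n))).toReal - k n * firstProb X (x n) ℓ) / (k n * wseq X x n) := by
      field_simp
    rw [e1, abs_div, abs_of_pos (mul_pos hk0 hw), div_le_iff₀ (mul_pos hk0 hw)]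
    refine hmain.trans (le_of_eq ?_)
    rw [wseq] at hw ⊢
    field_simp
  rw [Real.dist_eq] at h2 hℓ2 ⊢
  simp only [Function.comp_apply] at h2
  rw [abs_lt] at h2 hℓ2 ⊢
  rw [abs_le] at hdiv
  rw [wseq] at hdiv ⊢
  constructor <;> linarith [hdiv.1, hdiv.2, h2.1, h2.2, hℓ2.1, hℓ2.2]

lemma tendsto_measure_A1_div_of_ratio [IsProbabilityMeasure (ℙ : Measure Ω)]
    {X Y : ℤ → Ω → Vec d} (hXm : ∀ j, Measurable (X j)) (hYm : ∀ j, Measurable (Y j))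
    (hstat : Stationary X) (htail : IsTailProcess X Y)
    (hY0 : ∀ᵐ ω ∂ℙ, 1 < ‖Y 0 ω‖) {x : ℕ → ℝ} {r : ℕ → ℕ} (hR : condR X x r)
    (hDH : condDH X x r) {k : ℕ → ℕ} (hkr : ∀ n, k n ≤ r n) {a : ℝ} (ha : 0 < a)
    (hka : Tendsto (fun n => (k n : ℝ) / r n) atTop (𝓝 a)) :
    Tendsto (fun n => (ℙ (A1 X (x n) (k n))).toReal / (r n * wseq X x n)) atTop
      (𝓝 (a * theta Y)) := by
  have hr : Tendsto (fun n => (r n : ℝ)) atTop atTop :=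
    tendsto_natCast_atTop_atTop.comp hR.2.1
  have hk : Tendsto k atTop atTop := by
    rw [← tendsto_natCast_atTop_iff (R := ℝ)]
    refine (hka.pos_mul_atTop ha hr).congr' ?_
    filter_upwards [hr.eventually_gt_atTop 0] with n hn
    exact div_mul_cancel₀ _ hn.ne'
  refine (hka.mul (tendsto_measure_A1_div hXm hYm hstat htail hY0 hR hDH hk hkr)).congr' ?_
  filter_upwards [hk.eventually_ge_atTop 1] with n hn
  have hk0 : (k n : ℝ) ≠ 0 := by positivity
  field_simp

lemma excB_bddBelow (c : ℝ) (m : ℕ) (f : ℤ → Vec d) : BddBelow (excB c m f) :=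
  ⟨1, fun _ h => h.1⟩

lemma excB_bddAbove (c : ℝ) (m : ℕ) (f : ℤ → Vec d) : BddAbove (excB c m f) :=
  ⟨m, fun _ h => h.2.1⟩

lemma mul_lt_intCast_iff {q : ℝ} (hq : 0 ≤ q) (m : ℕ) (t : ℤ) :
    q * (m : ℝ) < (t : ℝ) ↔ ((⌊q * (m : ℝ)⌋₊ : ℕ) : ℤ) < t := by
  rw [Int.natCast_floor_eq_floor (by positivity), Int.floor_lt]

/-- The first exceedance is late iff the block has an exceedance but its initial part has none. -/
lemma setOf_lt_tmin_inter_A1 {Ω : Type*} (X : ℤ → Ω → Vec d) (c : ℝ) (m : ℕ) {q : ℝ}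
    (hq0 : 0 ≤ q) (hq1 : q ≤ 1) :
    {ω | q * (m : ℝ) < (tmin X c m ω : ℝ)} ∩ A1 X c m =
      A1 X c m \ A1 X c ⌊q * (m : ℝ)⌋₊ := by
  have hle : ⌊q * (m : ℝ)⌋₊ ≤ m := Nat.floor_le_of_le (mul_le_of_le_one_left m.cast_nonneg hq1)
  ext ω
  simp only [Set.mem_inter_iff, Set.mem_ofPred_eq, Set.mem_sdiff, mul_lt_intCast_iff hq0]
  rw [and_comm]
  refine and_congr_right fun hA => ?_
  have hmem : tmin X c m ω ∈ excB c m fun i => X i ω :=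
    Int.csInf_mem hA (excB_bddBelow _ _ _)
  constructor
  · rintro h ⟨i, h1, h2, h3⟩
    have : tmin X c m ω ≤ i := csInf_le (excB_bddBelow _ _ _) ⟨h1, by omega, h3⟩
    omega
  · intro h
    by_contra hlt
    exact h ⟨_, hmem.1, not_lt.1 hlt, hmem.2.2⟩

/-- The last exceedance is late iff the final part of the block has an exceedance. -/
lemma setOf_lt_tmax_inter_A1 {Ω : Type*} (X : ℤ → Ω → Vec d) (c : ℝ) (m : ℕ) {q : ℝ}
    (hq0 : 0 ≤ q) (hq1 : q ≤ 1) :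
    {ω | q * (m : ℝ) < (tmax X c m ω : ℝ)} ∩ A1 X c m =
      A1 (fun j => X (j + (⌊q * (m : ℝ)⌋₊ : ℕ))) c (m - ⌊q * (m : ℝ)⌋₊) := by
  have hle : ⌊q * (m : ℝ)⌋₊ ≤ m := Nat.floor_le_of_le (mul_le_of_le_one_left m.cast_nonneg hq1)
  ext ω
  simp only [Set.mem_inter_iff, Set.mem_ofPred_eq, mul_lt_intCast_iff hq0]
  constructor
  · rintro ⟨h, hA⟩
    have hmem : tmax X c m ω ∈ excB c m fun i => X i ω :=
      Int.csSup_mem hA (excB_bddAbove _ _ _)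
    obtain ⟨h1, h2, h3⟩ := hmem
    exact ⟨tmax X c m ω - (⌊q * (m : ℝ)⌋₊ : ℕ), by omega, by omega, by simpa using h3⟩
  · rintro ⟨i, h1, h2, h3⟩
    have hi : i + (⌊q * (m : ℝ)⌋₊ : ℕ) ∈ excB c m fun i => X i ω := ⟨by omega, by omega, h3⟩
    have : i + (⌊q * (m : ℝ)⌋₊ : ℕ) ≤ tmax X c m ω := le_csSup (excB_bddAbove _ _ _) hi
    exact ⟨by omega, _, hi⟩

lemma measurableSet_excB_nonempty (c : ℝ) (m : ℕ) :
    MeasurableSet {f : ℤ → Vec d | (excB c m f).Nonempty} := by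
  have e : {f : ℤ → Vec d | (excB c m f).Nonempty} =
      ⋃ i ∈ Set.Icc (1 : ℤ) m, {f : ℤ → Vec d | c < ‖f i‖} := by
    ext f
    simp [excB, Set.Nonempty, and_assoc]
  rw [e]
  exact MeasurableSet.biUnion (Set.to_countable _) fun i _ => measurableSet_lt_norm c i

/-- Under the anticlustering condition `DH`, for every `q ∈ (0,1)`, both
`(r_n w_n)⁻¹ P({t(1) > q r_n} ∩ A₁)` and `(r_n w_n)⁻¹ P({t(N₁) > q r_n} ∩ A₁)` converge
to `(1-q)·θ`. -/
theorem stmt_0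
    {d : ℕ} {Ω : Type*} [MeasureSpace Ω] [IsProbabilityMeasure (ℙ : Measure Ω)]
    (X Y : ℤ → Ω → Vec d)
    (hXm : ∀ j, Measurable (X j)) (hYm : ∀ j, Measurable (Y j))
    (hstat : Stationary X) (htail : IsTailProcess X Y)
    (hY0 : ∀ᵐ ω ∂ℙ, 1 < ‖Y 0 ω‖)
    (x : ℕ → ℝ) (r : ℕ → ℕ) (hR : condR X x r)
    (hDH : condDH X x r)
    (q : ℝ) (hq0 : 0 < q) (hq1 : q < 1) :
    Tendsto (fun n : ℕ =>
        (ℙ ({ω | q * (r n : ℝ) < (tmin X (x n) (r n) ω : ℝ)} ∩ A1 X (x n) (r n))).toReal /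
          ((r n : ℝ) * wseq X x n)) atTop (𝓝 ((1 - q) * theta Y)) ∧
    Tendsto (fun n : ℕ =>
        (ℙ ({ω | q * (r n : ℝ) < (tmax X (x n) (r n) ω : ℝ)} ∩ A1 X (x n) (r n))).toReal /
          ((r n : ℝ) * wseq X x n)) atTop (𝓝 ((1 - q) * theta Y)) := by
  have hfl : ∀ n, ⌊q * (r n : ℝ)⌋₊ ≤ r n := fun n =>
    Nat.floor_le_of_le (mul_le_of_le_one_left (r n).cast_nonneg hq1.le)
  have hr : Tendsto (fun n => (r n : ℝ)) atTop atTop :=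
    tendsto_natCast_atTop_atTop.comp hR.2.1
  have hone : Tendsto (fun n => (r n : ℝ) / r n) atTop (𝓝 1) := by
    refine tendsto_const_nhds.congr' ?_
    filter_upwards [hr.eventually_gt_atTop 0] with n hn
    exact (div_self hn.ne').symm
  have hq : Tendsto (fun n => (⌊q * (r n : ℝ)⌋₊ : ℝ) / r n) atTop (𝓝 q) :=
    (tendsto_nat_floor_mul_div_atTop hq0.le).comp hr
  have hsub : Tendsto (fun n => ((r n - ⌊q * (r n : ℝ)⌋₊ : ℕ) : ℝ) / r n) atTop (𝓝 (1 - q)) := by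
    refine (hone.sub hq).congr fun n => ?_
    rw [Nat.cast_sub (hfl n), sub_div]
  have hX : Measurable fun ω => (fun j : ℤ => X j ω) := by fun_prop
  constructor
  · have h1 := tendsto_measure_A1_div_of_ratio hXm hYm hstat htail hY0 hR hDH
      (fun n => le_rfl) one_pos hone
    have h2 := tendsto_measure_A1_div_of_ratio hXm hYm hstat htail hY0 hR hDH hfl hq0 hq
    rw [sub_mul]
    refine (h1.sub h2).congr fun n => ?_
    have hss : A1 X (x n) ⌊q * (r n : ℝ)⌋₊ ⊆ A1 X (x n) (r n) := by
      rintro ω ⟨i, hi1, hi2, hi3⟩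
      have := hfl n
      exact ⟨i, hi1, by omega, hi3⟩
    rw [setOf_lt_tmin_inter_A1 X _ _ hq0.le hq1.le, ← sub_div,
      measure_sdiff hss (hX (measurableSet_excB_nonempty _ _)).nullMeasurableSet
        (measure_ne_top _ _),
      ENNReal.toReal_sub_of_le (measure_mono hss) (measure_ne_top _ _)]
  · refine (tendsto_measure_A1_div_of_ratio hXm hYm hstat htail hY0 hR hDH
      (fun n => Nat.sub_le _ _) (sub_pos.2 hq1) hsub).congr fun n => ?_
    rw [setOf_lt_tmax_inter_A1 X _ _ hq0.le hq1.le]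
    congr 2
    exact (hstat.measure_shift hXm _ (measurableSet_excB_nonempty _ _)).symm

end ClusterPaper
end
end

section
/- Assume the anticlustering condition DH holds and let γ > 0. Then lim_{n→∞} E[t(1)^γ 1_{A_1}]/(r_n^{γ+1} w_n) = lim_{n→∞} E[(r_n − t(1))^γ 1_{A_1}]/(r_n^{γ+1} w_n) = θ/(γ+1), and the same two limits hold with t(N_1) in place of t(1). -/
open MeasureTheory ProbabilityTheory Filter Topology Asymptotics
open scoped Classical

noncomputable section

namespace ClusterPaper

variable {d : ℕ} {Ω : Type*} [MeasureSpace Ω]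

/-- Weights of size `O(1/r)` with total mass tending to `c`, applied to a sequence that is uniformly
close to `L` away from finitely many indices, give weighted sums tending to `c * L`. -/
theorem tendsto_weighted_sum {r : ℕ → ℕ} (hr : Tendsto r atTop atTop)
    {a q : ℕ → ℕ → ℝ} {c L : ℝ}
    (ha0 : ∀ n, ∀ k < r n, 0 ≤ a n k) (ha1 : ∀ n, ∀ k < r n, a n k ≤ 1 / (r n : ℝ))
    (hac : Tendsto (fun n => ∑ k ∈ Finset.range (r n), a n k) atTop (𝓝 c))
    (hq : ∀ n k, |q n k| ≤ 1)
    (hL : ∀ ε > 0, ∃ ℓ : ℕ, ∀ᶠ n in atTop, ∀ k, ℓ ≤ k → k ≤ r n → |q n k - L| ≤ ε) :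
    Tendsto (fun n => ∑ k ∈ Finset.range (r n), a n k * q n k) atTop (𝓝 (c * L)) := by
  have hc0 : 0 ≤ c := ge_of_tendsto' hac fun n =>
    Finset.sum_nonneg fun k hk => ha0 n k (Finset.mem_range.1 hk)
  have hdiff : Tendsto (fun n => ∑ k ∈ Finset.range (r n), a n k * (q n k - L)) atTop (𝓝 0) := by
    rw [Metric.tendsto_atTop']
    intro ε hε
    have hδ : 0 < ε / (2 * (c + 1)) := by positivity
    obtain ⟨ℓ, hℓ⟩ := hL _ hδ
    have hsmall : Tendsto (fun n => (ℓ * (1 + |L|)) / (r n : ℝ)) atTop (𝓝 0) :=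
      tendsto_const_nhds.div_atTop (tendsto_natCast_atTop_atTop.comp hr)
    have hev : ∀ᶠ n in atTop,
        |∑ k ∈ Finset.range (r n), a n k * (q n k - L)| < ε := by
      filter_upwards [hℓ, hsmall.eventually_lt_const (half_pos hε),
        hac.eventually_lt_const (lt_add_one c)] with n h1 h2 h3
      have hterm : ∀ k ∈ Finset.range (r n), |a n k * (q n k - L)| ≤
          (if k < ℓ then (1 + |L|) / (r n : ℝ) else 0) + a n k * (ε / (2 * (c + 1))) := by
        intro k hk
        have hk' := Finset.mem_range.1 hk
        rw [abs_mul, abs_of_nonneg (ha0 n k hk')]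
        split_ifs with hkl
        · have hb : |q n k - L| ≤ 1 + |L| := (abs_sub _ _).trans (by linarith [hq n k])
          have := mul_le_mul (ha1 n k hk') hb (abs_nonneg _) (by positivity)
          have h' : 0 ≤ a n k * (ε / (2 * (c + 1))) := mul_nonneg (ha0 n k hk') hδ.le
          calc _ ≤ 1 / (r n : ℝ) * (1 + |L|) := this
            _ = (1 + |L|) / (r n : ℝ) := by ring
            _ ≤ _ := by linarith
        · have := mul_le_mul_of_nonneg_left (h1 k (not_lt.1 hkl) hk'.le) (ha0 n k hk')
          linarith
      have hfin : ∑ k ∈ Finset.range (r n), (if k < ℓ then (1 + |L|) / (r n : ℝ) else 0) ≤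
          (ℓ * (1 + |L|)) / (r n : ℝ) := by
        rw [← Finset.sum_filter, Finset.sum_const, nsmul_eq_mul, mul_div_assoc]
        refine mul_le_mul_of_nonneg_right ?_ (by positivity)
        have : (Finset.range (r n)).filter (· < ℓ) ⊆ Finset.range ℓ := fun k hk =>
          Finset.mem_range.2 (Finset.mem_filter.1 hk).2
        exact_mod_cast (Finset.card_le_card this).trans_eq (Finset.card_range ℓ)
      have hsum := (Finset.abs_sum_le_sum_abs _ _).trans (Finset.sum_le_sum hterm)
      rw [Finset.sum_add_distrib, ← Finset.sum_mul] at hsum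
      have h4 : (∑ k ∈ Finset.range (r n), a n k) * (ε / (2 * (c + 1))) ≤
          (c + 1) * (ε / (2 * (c + 1))) := mul_le_mul_of_nonneg_right h3.le hδ.le
      have h5 : (c + 1) * (ε / (2 * (c + 1))) = ε / 2 := by field_simp
      linarith
    obtain ⟨N, hN⟩ := eventually_atTop.1 hev
    exact ⟨N, fun n hn => by simpa [Real.dist_eq] using hN n (le_of_lt hn)⟩
  have := hdiff.add (hac.mul_const L)
  rw [zero_add] at this
  refine this.congr fun n => ?_
  rw [Finset.sum_mul, ← Finset.sum_add_distrib]
  exact Finset.sum_congr rfl fun k _ => by ring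

theorem sum_range_succ_rpow (γ : ℝ) (hγ : 0 < γ) (m : ℕ) :
    ∑ k ∈ Finset.range m, ((k : ℝ) + 1) ^ γ =
      ∑ k ∈ Finset.range m, (k : ℝ) ^ γ + (m : ℝ) ^ γ := by
  have h1 := Finset.sum_range_succ (fun k : ℕ => (k : ℝ) ^ γ) m
  have h2 := Finset.sum_range_succ' (fun k : ℕ => (k : ℝ) ^ γ) m
  simp only [Nat.cast_zero, Real.zero_rpow hγ.ne', add_zero, Nat.cast_add, Nat.cast_one] at h2
  rw [← h1, h2]

theorem sum_range_rpow_le (γ : ℝ) (hγ : 0 < γ) (m : ℕ) :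
    ∑ k ∈ Finset.range m, (k : ℝ) ^ γ ≤ (m : ℝ) ^ (γ + 1) / (γ + 1) := by
  have hmono : MonotoneOn (fun x : ℝ => x ^ γ) (Set.Icc 0 (0 + m)) := fun a ha b _ hab =>
    Real.rpow_le_rpow ha.1 hab hγ.le
  have := hmono.sum_le_integral
  simpa [integral_rpow (Or.inl (by linarith : (-1 : ℝ) < γ)),
    Real.zero_rpow (by linarith : γ + 1 ≠ 0)] using this

theorem le_sum_range_succ_rpow (γ : ℝ) (hγ : 0 < γ) (m : ℕ) :
    (m : ℝ) ^ (γ + 1) / (γ + 1) ≤ ∑ k ∈ Finset.range m, ((k : ℝ) + 1) ^ γ := by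
  have hmono : MonotoneOn (fun x : ℝ => x ^ γ) (Set.Icc 0 (0 + m)) := fun a ha b _ hab =>
    Real.rpow_le_rpow ha.1 hab hγ.le
  have := hmono.integral_le_sum
  simpa [integral_rpow (Or.inl (by linarith : (-1 : ℝ) < γ)),
    Real.zero_rpow (by linarith : γ + 1 ≠ 0)] using this

theorem tendsto_sum_range_rpow_div (γ : ℝ) (hγ : 0 < γ) :
    Tendsto (fun m : ℕ => ∑ k ∈ Finset.range m, (k : ℝ) ^ γ / (m : ℝ) ^ (γ + 1)) atTop
      (𝓝 (1 / (γ + 1))) := by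
  have hlow : Tendsto (fun m : ℕ => 1 / (γ + 1) - 1 / (m : ℝ)) atTop (𝓝 (1 / (γ + 1))) := by
    simpa using tendsto_const_nhds.sub (tendsto_one_div_atTop_nhds_zero_nat (𝕜 := ℝ))
  refine tendsto_of_tendsto_of_tendsto_of_le_of_le' hlow tendsto_const_nhds ?_ ?_ <;>
    filter_upwards [eventually_gt_atTop 0] with m hm <;>
    have hm' : (0 : ℝ) < m := Nat.cast_pos.2 hm <;>
    rw [← Finset.sum_div]
  · have h1 := le_sum_range_succ_rpow γ hγ m
    rw [sum_range_succ_rpow γ hγ] at h1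
    rw [le_div_iff₀ (by positivity)]
    have : (1 / (γ + 1) - 1 / (m : ℝ)) * (m : ℝ) ^ (γ + 1) =
        (m : ℝ) ^ (γ + 1) / (γ + 1) - (m : ℝ) ^ γ := by
      rw [Real.rpow_add_one hm'.ne']
      field_simp
    linarith
  · rw [div_le_iff₀ (by positivity)]
    have := sum_range_rpow_le γ hγ m
    linarith [one_div_mul_eq_div (γ + 1) ((m : ℝ) ^ (γ + 1))]

theorem tendsto_sum_range_succ_rpow_div (γ : ℝ) (hγ : 0 < γ) :
    Tendsto (fun m : ℕ => ∑ k ∈ Finset.range m, ((k : ℝ) + 1) ^ γ / (m : ℝ) ^ (γ + 1)) atTop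
      (𝓝 (1 / (γ + 1))) := by
  have h := (tendsto_sum_range_rpow_div γ hγ).add (tendsto_one_div_atTop_nhds_zero_nat (𝕜 := ℝ))
  rw [add_zero] at h
  refine h.congr' ?_
  filter_upwards [eventually_gt_atTop 0] with m hm
  have hm' : (0 : ℝ) < m := Nat.cast_pos.2 hm
  rw [← Finset.sum_div, ← Finset.sum_div, sum_range_succ_rpow γ hγ, add_div,
    Real.rpow_add_one hm'.ne']
  field_simp

theorem rpow_div_rpow_add_one_le {γ a m : ℝ} (hγ : 0 < γ) (ha : 0 ≤ a) (ham : a ≤ m) (hm : 0 < m) :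
    a ^ γ / m ^ (γ + 1) ≤ 1 / m := by
  rw [Real.rpow_add_one hm.ne', div_le_div_iff₀ (by positivity) hm, one_mul]
  exact mul_le_mul_of_nonneg_right (Real.rpow_le_rpow ha ham hγ.le) hm.le

/-- The upper portmanteau bound for closed sets under convergence to the tail process. -/
theorem eventually_measureReal_le [IsProbabilityMeasure (ℙ : Measure Ω)] {X Y : ℤ → Ω → Vec d}
    (hXm : ∀ j, Measurable (X j)) (hYm : ∀ j, Measurable (Y j)) (htail : IsTailProcess X Y)
    {i j : ℤ} (hij : i ≤ j) {G : (ℤ → Vec d) → ℝ} (hG : Continuous G)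
    (hwin : ∀ u v : ℤ → Vec d, (∀ k : ℤ, i ≤ k → k ≤ j → u k = v k) → G u = G v)
    {F : Set ℝ} (hF : IsClosed F) {c : ℝ}
    (hc : (ℙ : Measure Ω).real {ω | G (fun k => Y k ω) ∈ F} < c) :
    ∀ᶠ t : ℝ in atTop,
      (ℙ : Measure Ω).real {ω | t < ‖X 0 ω‖ ∧ G (fun k => t⁻¹ • X k ω) ∈ F} ≤
        c * (ℙ : Measure Ω).real {ω | t < ‖X 0 ω‖} := by
  have hGY : Measurable fun ω => G (fun k => Y k ω) :=
    hG.measurable.comp (measurable_pi_lambda _ hYm)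
  have hmap : (Measure.map (fun ω => G (fun k => Y k ω)) (ℙ : Measure Ω)).real F < c := by
    rwa [map_measureReal_apply hGY hF.measurableSet]
  have hprob := Measure.isProbabilityMeasure_map (μ := (ℙ : Measure Ω)) hGY.aemeasurable
  have hlim := tendsto_integral_thickenedIndicator_of_isClosed
    (Measure.map (fun ω => G (fun k => Y k ω)) (ℙ : Measure Ω)) hF
    (δs := fun n : ℕ => 1 / ((n : ℝ) + 1)) (fun n => by positivity)
    tendsto_one_div_add_atTop_nhds_zero_nat
  obtain ⟨m, hm⟩ := (hlim.eventually_lt_const hmap).exists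
  set φ := thickenedIndicator (by positivity : 0 < 1 / ((m : ℝ) + 1)) F with hφ
  have hφc : Continuous fun s => (φ s : ℝ) := by fun_prop
  have hφ1 : ∀ s, (φ s : ℝ) ≤ 1 := fun s =>
    NNReal.coe_le_one.2 (thickenedIndicator_le_one (by positivity : 0 < 1 / ((m : ℝ) + 1)) F s)
  rw [integral_map hGY.aemeasurable hφc.aestronglyMeasurable] at hm
  have ht := htail i j hij (fun u => (φ (G u) : ℝ)) (hφc.comp hG)
    ⟨1, fun u => by rw [abs_of_nonneg (NNReal.coe_nonneg _)]; exact hφ1 _⟩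
    (fun u v huv => by rw [hwin u v huv])
  filter_upwards [ht.eventually_lt_const hm] with t htc
  have hA : MeasurableSet {ω | t < ‖X 0 ω‖} := measurableSet_lt measurable_const (hXm 0).norm
  have hGX : Measurable fun ω => G (fun k => t⁻¹ • X k ω) :=
    hG.measurable.comp (measurable_pi_lambda _ fun k => (hXm k).const_smul t⁻¹)
  rcases (measureReal_nonneg (μ := (ℙ : Measure Ω)) (s := {ω | t < ‖X 0 ω‖})).eq_or_lt with h0 | h0
  · rw [← h0, mul_zero, h0]
    exact measureReal_mono fun ω hω => hω.1
  · change _ / (ℙ : Measure Ω).real _ < c at htc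
    rw [div_lt_iff₀ h0] at htc
    refine le_trans ?_ htc.le
    have hB : MeasurableSet {ω | G (fun k => t⁻¹ • X k ω) ∈ F} := hGX hF.measurableSet
    have hind : (ℙ : Measure Ω).real {ω | t < ‖X 0 ω‖ ∧ G (fun k => t⁻¹ • X k ω) ∈ F} =
        ∫ ω in {ω | t < ‖X 0 ω‖},
          {ω | G (fun k => t⁻¹ • X k ω) ∈ F}.indicator (fun _ => (1 : ℝ)) ω := by
      rw [integral_indicator_const _ hB, smul_eq_mul, mul_one, measureReal_restrict_apply hB]
      congr 1
      ext ω
      exact and_comm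
    rw [hind]
    refine integral_mono ((integrable_const 1).indicator hB) ?_ fun ω => ?_
    · refine Integrable.of_bound (hφc.measurable.comp hGX).aestronglyMeasurable 1
        (ae_of_all _ fun ω => ?_)
      simpa using hφ1 _
    · by_cases hω : G (fun k => t⁻¹ • X k ω) ∈ F
      · simp only [Set.indicator, Set.mem_ofPred_eq, hω, if_true]
        have := thickenedIndicator_one (by positivity : 0 < 1 / ((m : ℝ) + 1)) F hω
        rw [hφ, this]
        simp
      · simp [Set.indicator, hω]

theorem Stationary.measureReal_shift {X : ℤ → Ω → Vec d} (hstat : Stationary X)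
    (hXm : ∀ j, Measurable (X j)) {S : Set (ℤ → Vec d)} (hS : MeasurableSet S) (k : ℤ) :
    (ℙ : Measure Ω).real {ω | (fun j => X (j + k) ω) ∈ S} =
      (ℙ : Measure Ω).real {ω | (fun j => X j ω) ∈ S} := by
  have h : (Measure.map (fun ω => (fun j : ℤ => X (j + k) ω)) ℙ).real S =
      (Measure.map (fun ω => (fun j : ℤ => X j ω)) ℙ).real S := by rw [hstat k]
  rwa [map_measureReal_apply (measurable_pi_lambda _ fun j => hXm (j + k)) hS,
    map_measureReal_apply (measurable_pi_lambda _ hXm) hS] at h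

/-- The marginals of the tail process have no mass on the unit sphere. -/
theorem measureReal_norm_tail_eq_one [IsProbabilityMeasure (ℙ : Measure Ω)] {X Y : ℤ → Ω → Vec d}
    (hXm : ∀ j, Measurable (X j)) (hYm : ∀ j, Measurable (Y j)) (hstat : Stationary X)
    (htail : IsTailProcess X Y) (hY0 : ∀ᵐ ω ∂ℙ, 1 < ‖Y 0 ω‖)
    (hpos : ∀ t : ℝ, 0 < (ℙ : Measure Ω).real {ω | t < ‖X 0 ω‖}) (j : ℤ) :
    (ℙ : Measure Ω).real {ω | ‖Y j ω‖ = 1} = 0 := by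
  by_contra hne
  set p := (ℙ : Measure Ω).real {ω | ‖Y j ω‖ = 1} with hp
  have hp0 : 0 < p := lt_of_le_of_ne measureReal_nonneg (Ne.symm hne)
  have hp1 : p ≤ 1 := measureReal_le_one
  have hY0lim : Tendsto (fun m : ℕ => (ℙ : Measure Ω).real {ω | ‖Y 0 ω‖ ≤ 1 + 1 / ((m : ℝ) + 1)})
      atTop (𝓝 0) := by
    have hanti : Antitone fun m : ℕ => {ω | ‖Y 0 ω‖ ≤ 1 + 1 / ((m : ℝ) + 1)} := by
      intro a b hab ω hω
      simp only [Set.mem_ofPred_eq] at hω ⊢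
      have : 1 / ((b : ℝ) + 1) ≤ 1 / ((a : ℝ) + 1) := by gcongr
      linarith
    have h := tendsto_measure_iInter_atTop (μ := (ℙ : Measure Ω))
      (fun m : ℕ => (measurableSet_le (hYm 0).norm
        (measurable_const (a := 1 + 1 / ((m : ℝ) + 1)))).nullMeasurableSet)
      hanti ⟨0, measure_ne_top _ _⟩
    have h0 : ℙ (⋂ m : ℕ, {ω | ‖Y 0 ω‖ ≤ 1 + 1 / ((m : ℝ) + 1)}) = 0 := by
      refine measure_mono_null (fun ω hω => ?_) (ae_iff.1 hY0)
      rw [Set.mem_iInter] at hω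
      refine not_lt.2 (ge_of_tendsto' (x := atTop) ?_ hω)
      simpa using (tendsto_one_div_add_atTop_nhds_zero_nat (𝕜 := ℝ)).const_add 1
    rw [h0] at h
    exact (ENNReal.tendsto_toReal ENNReal.zero_ne_top).comp h
  obtain ⟨m, hm⟩ := (hY0lim.eventually_lt_const (by positivity : 0 < p / 4)).exists
  set c : ℝ := 1 + 1 / ((m : ℝ) + 1) with hc
  have hc1 : 1 < c := by rw [hc]; linarith [show 0 < 1 / ((m : ℝ) + 1) by positivity]
  set b : ℝ := 2 / (c + 1) with hb
  have hb0 : 0 < b := by positivity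
  have hb1 : b < 1 := by rw [hb, div_lt_one (by linarith)]; linarith
  have hcb : 1 < c * b := by rw [hb, ← mul_div_assoc, one_lt_div (by linarith)]; linarith
  have h1 := eventually_measureReal_le hXm hYm htail le_rfl (G := fun u => ‖u 0‖)
    (by fun_prop) (fun u v huv => by rw [huv 0 le_rfl le_rfl]) (isClosed_Iic (a := c)) hm
  have hK : (ℙ : Measure Ω).real {ω | ‖Y j ω‖ ∈ (Set.Ioo b (c * b))ᶜ} < 1 - p / 2 := by
    have hsub : {ω | ‖Y j ω‖ ∈ (Set.Ioo b (c * b))ᶜ} ⊆ {ω | ‖Y j ω‖ = 1}ᶜ := by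
      intro ω hω h
      exact hω (by rw [show ‖Y j ω‖ = 1 from h]; exact ⟨hb1, hcb⟩)
    have := measureReal_mono (μ := (ℙ : Measure Ω)) hsub
    rw [probReal_compl_eq_one_sub
      (measurableSet_eq_fun (hYm j).norm measurable_const)] at this
    linarith
  have h2 := eventually_measureReal_le hXm hYm htail le_rfl (i := j) (G := fun u => ‖u j‖)
    (by fun_prop) (fun u v huv => by rw [huv j le_rfl le_rfl]) isOpen_Ioo.isClosed_compl hK
  have h1' := (tendsto_id.const_mul_atTop hb0).eventually h1
  obtain ⟨t, ht2, ht1, ht0⟩ := (h2.and (h1'.and (eventually_gt_atTop 0))).exists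
  simp only [id] at ht1
  have hy0 : 0 < b * t := by positivity
  have hcover : {ω | t < ‖X 0 ω‖} ⊆
      {ω | t < ‖X 0 ω‖ ∧ ‖t⁻¹ • X j ω‖ ∈ (Set.Ioo b (c * b))ᶜ} ∪
        {ω | (fun k => X (k + j) ω) ∈
          {u : ℤ → Vec d | b * t < ‖u 0‖ ∧ ‖(b * t)⁻¹ • u 0‖ ∈ Set.Iic c}} := by
    intro ω hω
    by_cases hin : ‖t⁻¹ • X j ω‖ ∈ Set.Ioo b (c * b)
    · right
      rw [norm_smul, norm_inv, Real.norm_of_nonneg ht0.le, Set.mem_Ioo,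
        inv_mul_eq_div, lt_div_iff₀ ht0, div_lt_iff₀ ht0] at hin
      simp only [Set.mem_ofPred_eq, zero_add, Set.mem_Iic]
      rw [norm_smul, norm_inv, Real.norm_of_nonneg hy0.le, inv_mul_eq_div, div_le_iff₀ hy0]
      exact ⟨hin.1, by linarith [hin.2]⟩
    · exact Or.inl ⟨hω, hin⟩
  have hS : MeasurableSet
      {u : ℤ → Vec d | b * t < ‖u 0‖ ∧ ‖(b * t)⁻¹ • u 0‖ ∈ Set.Iic c} := by
    refine (measurableSet_lt measurable_const (measurable_pi_apply 0).norm).inter ?_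
    exact (((measurable_pi_apply 0).const_smul (b * t)⁻¹).norm) measurableSet_Iic
  have h3 := (measureReal_mono (μ := (ℙ : Measure Ω)) hcover).trans (measureReal_union_le _ _)
  rw [hstat.measureReal_shift hXm hS j] at h3
  have hcover' : {ω | b * t < ‖X 0 ω‖} ⊆
      {ω | b * t < ‖X 0 ω‖ ∧ ‖(b * t)⁻¹ • X 0 ω‖ ∈ Set.Iic c} ∪ {ω | t < ‖X 0 ω‖} := by
    intro ω hω
    by_cases hin : ‖(b * t)⁻¹ • X 0 ω‖ ∈ Set.Iic c
    · exact Or.inl ⟨hω, hin⟩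
    · right
      rw [Set.mem_Iic, not_le, norm_smul, norm_inv, Real.norm_of_nonneg hy0.le, inv_mul_eq_div,
        lt_div_iff₀ hy0] at hin
      have : 1 * t < c * b * t := mul_lt_mul_of_pos_right hcb ht0
      simp only [Set.mem_ofPred_eq]
      linarith
  have h4 := (measureReal_mono (μ := (ℙ : Measure Ω)) hcover').trans (measureReal_union_le _ _)
  have hFy := hpos (b * t)
  simp only [Set.mem_ofPred_eq] at h3
  set Fx := (ℙ : Measure Ω).real {ω | t < ‖X 0 ω‖}
  set Fy := (ℙ : Measure Ω).real {ω | b * t < ‖X 0 ω‖}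
  have h5 : p / 2 * Fx ≤ p / 4 * Fy := by linarith
  have h6 : Fy ≤ p / 4 * Fy + Fx := by linarith
  have h7 : 3 / 4 * Fy ≤ Fx := by nlinarith
  nlinarith

/-- Sequences exceeding `t` at `0` and staying below `t` at the next `k` positions in
direction `σ`. -/
def runEvent (d : ℕ) (σ : ℤ) (t : ℝ) (k : ℕ) : Set (ℤ → Vec d) :=
  {u | t < ‖u 0‖ ∧ ∀ j ∈ Finset.Icc 1 k, ‖u (σ * (j : ℕ))‖ ≤ t}

theorem measurableSet_runEvent (σ : ℤ) (t : ℝ) (k : ℕ) : MeasurableSet (runEvent d σ t k) := by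
  have : runEvent d σ t k = {u | t < ‖u 0‖} ∩
      ⋂ j ∈ Finset.Icc 1 k, {u | ‖u (σ * (j : ℕ))‖ ≤ t} := by
    ext u
    simp [runEvent]
  rw [this]
  exact (measurableSet_lt measurable_const (measurable_pi_apply 0).norm).inter
    (Finset.measurableSet_biInter _ fun j _ =>
      measurableSet_le (measurable_pi_apply _).norm measurable_const)

/-- The probability that `X` belongs to `runEvent`. -/
def runProb (X : ℤ → Ω → Vec d) (σ : ℤ) (t : ℝ) (k : ℕ) : ℝ :=
  (ℙ : Measure Ω).real {ω | (fun j => X j ω) ∈ runEvent d σ t k}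

/-- The limiting probability that the tail process has no exceedance in direction `σ`. -/
def dirTheta (Y : ℤ → Ω → Vec d) (σ : ℤ) : ℝ :=
  (ℙ : Measure Ω).real {ω | ∀ j : ℕ, 1 ≤ j → ‖Y (σ * j) ω‖ ≤ 1}

/-- The maximal norm over the first `k` positions in direction `σ`. -/
def runMax (σ : ℤ) (k : ℕ) (u : ℤ → Vec d) : ℝ :=
  ((Finset.Icc 1 k).sup fun j : ℕ => ‖u (σ * j)‖₊ : NNReal)

theorem continuous_runMax (σ : ℤ) (k : ℕ) : Continuous (runMax (d := d) σ k) :=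
  NNReal.continuous_coe.comp (Continuous.finset_sup_apply fun j _ => by fun_prop)

theorem runMax_le_one {σ : ℤ} {k : ℕ} {u : ℤ → Vec d} :
    runMax σ k u ≤ 1 ↔ ∀ j ∈ Finset.Icc 1 k, ‖u (σ * (j : ℕ))‖ ≤ 1 := by
  rw [runMax, NNReal.coe_le_one, Finset.sup_le_iff]
  exact Iff.rfl

theorem one_le_runMax {σ : ℤ} {k : ℕ} {u : ℤ → Vec d} :
    1 ≤ runMax σ k u ↔ ∃ j ∈ Finset.Icc 1 k, 1 ≤ ‖u (σ * (j : ℕ))‖ := by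
  rw [runMax, NNReal.one_le_coe, Finset.le_sup_iff (by simp)]
  exact Iff.rfl

theorem runMax_inv_smul_le_one {σ : ℤ} {k : ℕ} {u : ℤ → Vec d} {t : ℝ} (ht : 0 < t) :
    runMax σ k (fun j => t⁻¹ • u j) ≤ 1 ↔ ∀ j ∈ Finset.Icc 1 k, ‖u (σ * (j : ℕ))‖ ≤ t := by
  rw [runMax_le_one]
  simp only [norm_smul, norm_inv, Real.norm_of_nonneg ht.le, inv_mul_eq_div, div_le_one ht]

theorem runProb_nonneg (X : ℤ → Ω → Vec d) (σ : ℤ) (t : ℝ) (k : ℕ) : 0 ≤ runProb X σ t k :=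
  measureReal_nonneg

theorem runProb_le [IsProbabilityMeasure (ℙ : Measure Ω)] (X : ℤ → Ω → Vec d) (σ : ℤ) (t : ℝ)
    (k : ℕ) : runProb X σ t k ≤ (ℙ : Measure Ω).real {ω | t < ‖X 0 ω‖} :=
  measureReal_mono fun _ hω => hω.1

theorem tendsto_runProb_div [IsProbabilityMeasure (ℙ : Measure Ω)] {X Y : ℤ → Ω → Vec d}
    (hXm : ∀ j, Measurable (X j)) (hYm : ∀ j, Measurable (Y j)) (hstat : Stationary X)
    (htail : IsTailProcess X Y) (hY0 : ∀ᵐ ω ∂ℙ, 1 < ‖Y 0 ω‖)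
    (hpos : ∀ t : ℝ, 0 < (ℙ : Measure Ω).real {ω | t < ‖X 0 ω‖})
    {σ : ℤ} (hσ : |σ| = 1) (k : ℕ) :
    Tendsto (fun t => runProb X σ t k / (ℙ : Measure Ω).real {ω | t < ‖X 0 ω‖}) atTop
      (𝓝 ((ℙ : Measure Ω).real {ω | runMax σ k (fun j => Y j ω) ≤ 1})) := by
  set a := (ℙ : Measure Ω).real {ω | runMax σ k (fun j => Y j ω) ≤ 1} with ha
  have hwin : ∀ u v : ℤ → Vec d, (∀ l : ℤ, -(k : ℤ) ≤ l → l ≤ k → u l = v l) →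
      runMax σ k u = runMax σ k v := by
    intro u v huv
    unfold runMax
    congr 1
    refine Finset.sup_congr rfl fun j hj => ?_
    have hj' := Finset.mem_Icc.1 hj
    have habs : |σ * (j : ℤ)| ≤ k := by
      rw [abs_mul, hσ, one_mul, Nat.abs_cast]
      exact_mod_cast hj'.2
    rw [huv _ (abs_le.1 habs).1 (abs_le.1 habs).2]
  have hmeas : Measurable fun ω => runMax σ k (fun j => Y j ω) :=
    (continuous_runMax σ k).measurable.comp (measurable_pi_lambda _ hYm)
  have hge : (ℙ : Measure Ω).real {ω | runMax σ k (fun j => Y j ω) ∈ Set.Ici 1} ≤ 1 - a := by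
    have hnull : (ℙ : Measure Ω).real (⋃ j ∈ Finset.Icc 1 k, {ω | ‖Y (σ * (j : ℕ)) ω‖ = 1}) = 0 := by
      refine le_antisymm ((measureReal_biUnion_finset_le _ _).trans_eq ?_) measureReal_nonneg
      exact Finset.sum_eq_zero fun j _ =>
        measureReal_norm_tail_eq_one hXm hYm hstat htail hY0 hpos _
    have hsub : {ω | runMax σ k (fun j => Y j ω) ∈ Set.Ici 1} ⊆
        {ω | runMax σ k (fun j => Y j ω) ≤ 1}ᶜ ∪
          ⋃ j ∈ Finset.Icc 1 k, {ω | ‖Y (σ * (j : ℕ)) ω‖ = 1} := by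
      intro ω hω
      by_cases hle : runMax σ k (fun j => Y j ω) ≤ 1
      · right
        obtain ⟨j, hj, hj1⟩ := one_le_runMax.1 hω
        exact Set.mem_biUnion hj (le_antisymm (runMax_le_one.1 hle j hj) hj1)
      · exact Or.inl hle
    have h := (measureReal_mono (μ := (ℙ : Measure Ω)) hsub).trans (measureReal_union_le _ _)
    rwa [hnull, add_zero, probReal_compl_eq_one_sub (measurableSet_le hmeas measurable_const)] at h
  rw [Metric.tendsto_nhds]
  intro ε hε
  have hup := eventually_measureReal_le hXm hYm htail (by omega : -(k : ℤ) ≤ k)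
    (continuous_runMax σ k) hwin (isClosed_Iic (a := (1 : ℝ))) (c := a + ε / 2)
    (by change a < _; linarith)
  have hlow := eventually_measureReal_le hXm hYm htail (by omega : -(k : ℤ) ≤ k)
    (continuous_runMax σ k) hwin (isClosed_Ici (a := (1 : ℝ))) (c := 1 - a + ε / 2)
    (by linarith)
  filter_upwards [hup, hlow, eventually_gt_atTop 0] with t h1 h2 ht
  have hev : {ω | t < ‖X 0 ω‖ ∧ runMax σ k (fun j => t⁻¹ • X j ω) ∈ Set.Iic 1} =
      {ω | (fun j => X j ω) ∈ runEvent d σ t k} := by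
    ext ω
    exact and_congr_right fun _ => runMax_inv_smul_le_one (u := fun j => X j ω) ht
  rw [hev] at h1
  change runProb X σ t k ≤ _ at h1
  have hcover : {ω | t < ‖X 0 ω‖} ⊆ {ω | (fun j => X j ω) ∈ runEvent d σ t k} ∪
      {ω | t < ‖X 0 ω‖ ∧ runMax σ k (fun j => t⁻¹ • X j ω) ∈ Set.Ici 1} := by
    intro ω hω
    rw [← hev]
    rcases le_total (runMax σ k (fun j => t⁻¹ • X j ω)) 1 with h | h
    · exact Or.inl ⟨hω, h⟩
    · exact Or.inr ⟨hω, h⟩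
  have h3 := (measureReal_mono (μ := (ℙ : Measure Ω)) hcover).trans (measureReal_union_le _ _)
  change _ ≤ runProb X σ t k + _ at h3
  have hF := hpos t
  rw [Real.dist_eq, abs_lt, lt_sub_iff_add_lt, sub_lt_iff_lt_add, lt_div_iff₀ hF, div_lt_iff₀ hF]
  constructor <;> nlinarith

theorem tendsto_measureReal_runMax_le_one [IsProbabilityMeasure (ℙ : Measure Ω)]
    {Y : ℤ → Ω → Vec d} (hYm : ∀ j, Measurable (Y j)) (σ : ℤ) :
    Tendsto (fun k : ℕ => (ℙ : Measure Ω).real {ω | runMax σ k (fun j => Y j ω) ≤ 1}) atTop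
      (𝓝 (dirTheta Y σ)) := by
  have hanti : Antitone fun k : ℕ => {ω | runMax σ k (fun j => Y j ω) ≤ 1} := by
    intro a b hab ω hω
    exact runMax_le_one.2 fun j hj => runMax_le_one.1 hω j
      (Finset.Icc_subset_Icc_right hab hj)
  have h := tendsto_measure_iInter_atTop (μ := (ℙ : Measure Ω))
    (fun k : ℕ => (measurableSet_le
      ((continuous_runMax σ k).measurable.comp (measurable_pi_lambda _ hYm))
      (measurable_const (a := (1 : ℝ)))).nullMeasurableSet) hanti ⟨0, measure_ne_top _ _⟩
  have hset : ⋂ k : ℕ, {ω | runMax σ k (fun j => Y j ω) ≤ 1} =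
      {ω | ∀ j : ℕ, 1 ≤ j → ‖Y (σ * j) ω‖ ≤ 1} := by
    ext ω
    simp only [Set.mem_iInter, Set.mem_ofPred_eq, runMax_le_one, Finset.mem_Icc]
    exact ⟨fun h j hj => h j j ⟨hj, le_rfl⟩, fun h k j hj => h j hj.1⟩
  change Tendsto _ _ (𝓝 (ℙ (⋂ k : ℕ, {ω | runMax σ k (fun j => Y j ω) ≤ 1}))) at h
  rw [hset] at h
  exact (ENNReal.tendsto_toReal (measure_ne_top _ _)).comp h

/-- Under anticlustering, the conditional probability of no exceedance among the next `k` positions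
in direction `σ` is close to its limit uniformly in `ℓ ≤ k ≤ r n`. -/
theorem eventually_abs_runProb_div_sub_le [IsProbabilityMeasure (ℙ : Measure Ω)]
    {X Y : ℤ → Ω → Vec d}
    (hXm : ∀ j, Measurable (X j)) (hYm : ∀ j, Measurable (Y j)) (hstat : Stationary X)
    (htail : IsTailProcess X Y) (hY0 : ∀ᵐ ω ∂ℙ, 1 < ‖Y 0 ω‖)
    (hpos : ∀ t : ℝ, 0 < (ℙ : Measure Ω).real {ω | t < ‖X 0 ω‖})
    {x : ℕ → ℝ} {r : ℕ → ℕ} (hx : Tendsto x atTop atTop) (hDH : condDH X x r)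
    {σ : ℤ} (hσ : |σ| = 1) {ε : ℝ} (hε : 0 < ε) :
    ∃ ℓ : ℕ, ∀ᶠ n in atTop, ∀ k, ℓ ≤ k → k ≤ r n →
      |runProb X σ (x n) k / wseq X x n - dirTheta Y σ| ≤ ε := by
  have hD := hDH 1 1 one_pos one_pos
  simp only [mul_one] at hD
  obtain ⟨ℓ, hℓ1, hℓ2⟩ := ((hD.eventually_lt_const (half_pos hε)).and
    (Metric.tendsto_nhds.1 (tendsto_measureReal_runMax_le_one hYm σ) (ε / 4)
      (by positivity))).exists
  have hbdd : ∀ᶠ n in atTop, (ℙ {ω | (∃ j : ℤ, (ℓ : ℤ) ≤ |j| ∧ |j| ≤ (r n : ℤ) ∧ x n < ‖X j ω‖) ∧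
      x n < ‖X 0 ω‖}).toReal / (ℙ {ω | x n < ‖X 0 ω‖}).toReal < ε / 2 := by
    refine eventually_lt_of_limsup_lt hℓ1 (isBoundedUnder_of ⟨1, fun n => ?_⟩)
    exact div_le_one_of_le₀ (measureReal_mono (μ := (ℙ : Measure Ω)) fun ω hω => hω.2)
      measureReal_nonneg
  refine ⟨ℓ, ?_⟩
  filter_upwards [hbdd, hx.eventually (Metric.tendsto_nhds.1
    (tendsto_runProb_div hXm hYm hstat htail hY0 hpos hσ ℓ) (ε / 4) (by positivity))]
    with n h1 h2 k hk hkr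
  have hw : 0 < wseq X x n := hpos (x n)
  change _ / wseq X x n < _ at h1
  change dist (_ / wseq X x n) _ < _ at h2
  have hmono : runProb X σ (x n) k ≤ runProb X σ (x n) ℓ :=
    measureReal_mono fun ω hω => ⟨hω.1, fun j hj => hω.2 j (Finset.Icc_subset_Icc_right hk hj)⟩
  have hcover : {ω | (fun j => X j ω) ∈ runEvent d σ (x n) ℓ} ⊆
      {ω | (fun j => X j ω) ∈ runEvent d σ (x n) k} ∪
        {ω | (∃ j : ℤ, (ℓ : ℤ) ≤ |j| ∧ |j| ≤ (r n : ℤ) ∧ x n < ‖X j ω‖) ∧ x n < ‖X 0 ω‖} := by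
    intro ω hω
    by_cases h : ∀ j ∈ Finset.Icc 1 k, ‖X (σ * (j : ℕ)) ω‖ ≤ x n
    · exact Or.inl ⟨hω.1, h⟩
    · right
      push Not at h
      obtain ⟨j, hj, hjx⟩ := h
      have hj' := Finset.mem_Icc.1 hj
      have hℓj : ℓ < j := by
        by_contra hle
        exact absurd (hω.2 j (Finset.mem_Icc.2 ⟨hj'.1, not_lt.1 hle⟩)) (not_le.2 hjx)
      have habs : |σ * (j : ℤ)| = j := by rw [abs_mul, hσ, one_mul, Nat.abs_cast]
      exact ⟨⟨σ * j, by omega, by omega, hjx⟩, hω.1⟩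
  have h3 := (measureReal_mono (μ := (ℙ : Measure Ω)) hcover).trans (measureReal_union_le _ _)
  have h3' := div_le_div_of_nonneg_right h3 hw.le
  rw [add_div] at h3'
  have h4 := div_le_div_of_nonneg_right hmono hw.le
  change runProb X σ (x n) ℓ / _ ≤ runProb X σ (x n) k / _ + _ at h3'
  rw [Real.dist_eq, abs_lt] at h2 hℓ2
  rw [abs_le]
  change _ / wseq X x n ≤ _ + (ℙ _).toReal / _ at h3'
  constructor <;> linarith [h2.1, h2.2, hℓ2.1, hℓ2.2]

/-- Decomposition of an expectation over the position `m k` of the first exceedance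
met when a block is scanned in the direction opposite to `σ`. -/
theorem setIntegral_eq_sum_runProb [IsProbabilityMeasure (ℙ : Measure Ω)] {X : ℤ → Ω → Vec d}
    (hXm : ∀ j, Measurable (X j)) (hstat : Stationary X) (σ : ℤ) (t : ℝ) (r : ℕ)
    {A : Set Ω} {T : Ω → ℤ} {m : ℕ → ℤ} (hm : Function.Injective m)
    (hA : A = ⋃ k ∈ Finset.range r, {ω | (fun j => X (j + m k) ω) ∈ runEvent d σ t k})
    (hT : ∀ k < r, ∀ ω, (fun j => X (j + m k) ω) ∈ runEvent d σ t k → T ω = m k) (f : ℤ → ℝ) :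
    ∫ ω in A, f (T ω) ∂ℙ = ∑ k ∈ Finset.range r, f (m k) * runProb X σ t k := by
  have hmeas : ∀ k, MeasurableSet {ω | (fun j => X (j + m k) ω) ∈ runEvent d σ t k} := fun k =>
    (measurable_pi_lambda _ fun j => hXm (j + m k)) (measurableSet_runEvent σ t k)
  have hEq : ∀ k ∈ Finset.range r, Set.EqOn (fun ω => f (T ω)) (fun _ => f (m k))
      {ω | (fun j => X (j + m k) ω) ∈ runEvent d σ t k} := fun k hk ω hω => by
    simp only [hT k (Finset.mem_range.1 hk) ω hω]
  rw [hA, integral_biUnion_finset _ (fun k _ => hmeas k)]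
  · refine Finset.sum_congr rfl fun k hk => ?_
    rw [setIntegral_congr_fun (hmeas k) (hEq k hk), setIntegral_const, smul_eq_mul, mul_comm,
      hstat.measureReal_shift hXm (measurableSet_runEvent σ t k)]
    rfl
  · intro k hk l hl hkl
    refine Set.disjoint_left.2 fun ω h1 h2 => hkl (hm ?_)
    rw [← hT k (Finset.mem_range.1 hk) ω h1, ← hT l (Finset.mem_range.1 hl) ω h2]
  · exact fun k hk => (integrableOn_congr_fun (hEq k hk) (hmeas k)).2
      (integrableOn_const (measure_ne_top _ _))

theorem isLeast_excB_of_mem_runEvent {t : ℝ} {r k : ℕ} (hk : k < r) {u : ℤ → Vec d}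
    (h : (fun j => u (j + ((k : ℤ) + 1))) ∈ runEvent d (-1) t k) :
    IsLeast (excB t r u) ((k : ℤ) + 1) := by
  refine ⟨⟨by omega, by omega, by simpa using h.1⟩, fun i hi => ?_⟩
  by_contra hlt
  have h1 := h.2 (k + 1 - i).toNat (Finset.mem_Icc.2 ⟨by omega, by have := hi.1; omega⟩)
  have h2 : -1 * (((k + 1 - i).toNat : ℕ) : ℤ) + ((k : ℤ) + 1) = i := by omega
  simp only [h2] at h1
  exact absurd hi.2.2 (not_lt.2 h1)

theorem isGreatest_excB_of_mem_runEvent {t : ℝ} {r k : ℕ} (hk : k < r) {u : ℤ → Vec d}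
    (h : (fun j => u (j + ((r : ℤ) - k))) ∈ runEvent d 1 t k) :
    IsGreatest (excB t r u) ((r : ℤ) - k) := by
  refine ⟨⟨by omega, by omega, by simpa using h.1⟩, fun i hi => ?_⟩
  by_contra hlt
  have h1 := h.2 (i - (r - k)).toNat (Finset.mem_Icc.2 ⟨by omega, by have := hi.2.1; omega⟩)
  have h2 : 1 * (((i - ((r : ℤ) - k)).toNat : ℕ) : ℤ) + ((r : ℤ) - k) = i := by omega
  simp only [h2] at h1
  exact absurd hi.2.2 (not_lt.2 h1)

theorem A1_eq_biUnion_tmin {S : Type*} (X : ℤ → S → Vec d) (t : ℝ) (r : ℕ) :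
    A1 X t r = ⋃ k ∈ Finset.range r,
      {ω | (fun j => X (j + ((k : ℤ) + 1)) ω) ∈ runEvent d (-1) t k} := by
  ext ω
  simp only [Set.mem_iUnion, exists_prop]
  constructor
  · intro hω
    have hbdd : BddBelow (excB t r fun i => X i ω) := ⟨1, fun i hi => hi.1⟩
    obtain ⟨h1, h2, h3⟩ := Int.csInf_mem hω hbdd
    set i := sInf (excB t r fun i => X i ω) with hi
    refine ⟨(i - 1).toNat, Finset.mem_range.2 (by omega), ?_, fun j hj => ?_⟩
    · have : 0 + (((i - 1).toNat : ℤ) + 1) = i := by omega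
      simpa only [this] using h3
    · have hj' := Finset.mem_Icc.1 hj
      have hlt : -1 * (j : ℤ) + (((i - 1).toNat : ℤ) + 1) < i := by omega
      by_contra hgt
      exact absurd (csInf_le hbdd ⟨by omega, by omega, not_le.1 hgt⟩) (not_le.2 hlt)
  · rintro ⟨k, hk, h⟩
    exact ⟨_, (isLeast_excB_of_mem_runEvent (u := fun i => X i ω) (Finset.mem_range.1 hk) h).1⟩

theorem A1_eq_biUnion_tmax {S : Type*} (X : ℤ → S → Vec d) (t : ℝ) (r : ℕ) :
    A1 X t r = ⋃ k ∈ Finset.range r,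
      {ω | (fun j => X (j + ((r : ℤ) - k)) ω) ∈ runEvent d 1 t k} := by
  ext ω
  simp only [Set.mem_iUnion, exists_prop]
  constructor
  · intro hω
    have hbdd : BddAbove (excB t r fun i => X i ω) := ⟨r, fun i hi => hi.2.1⟩
    obtain ⟨h1, h2, h3⟩ := Int.csSup_mem hω hbdd
    set i := sSup (excB t r fun i => X i ω) with hi
    refine ⟨(r - i).toNat, Finset.mem_range.2 (by omega), ?_, fun j hj => ?_⟩
    · have : 0 + ((r : ℤ) - ((r - i).toNat : ℤ)) = i := by omega
      simpa only [this] using h3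
    · have hj' := Finset.mem_Icc.1 hj
      have hlt : i < 1 * (j : ℤ) + ((r : ℤ) - ((r - i).toNat : ℤ)) := by omega
      by_contra hgt
      exact absurd (le_csSup hbdd ⟨by omega, by omega, not_le.1 hgt⟩) (not_le.2 hlt)
  · rintro ⟨k, hk, h⟩
    exact ⟨_, (isGreatest_excB_of_mem_runEvent (u := fun i => X i ω) (Finset.mem_range.1 hk) h).1⟩

theorem setIntegral_tmin_eq_sum [IsProbabilityMeasure (ℙ : Measure Ω)] {X : ℤ → Ω → Vec d}
    (hXm : ∀ j, Measurable (X j)) (hstat : Stationary X) (t : ℝ) (r : ℕ) (f : ℤ → ℝ) :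
    ∫ ω in A1 X t r, f (tmin X t r ω) ∂ℙ =
      ∑ k ∈ Finset.range r, f ((k : ℤ) + 1) * runProb X (-1) t k :=
  setIntegral_eq_sum_runProb hXm hstat (-1) t r (m := fun k => (k : ℤ) + 1)
    (fun a b h => by simpa using h) (A1_eq_biUnion_tmin X t r)
    (fun _ hk ω h => (isLeast_excB_of_mem_runEvent (u := fun i => X i ω) hk h).csInf_eq) f

theorem setIntegral_tmax_eq_sum [IsProbabilityMeasure (ℙ : Measure Ω)] {X : ℤ → Ω → Vec d}
    (hXm : ∀ j, Measurable (X j)) (hstat : Stationary X) (t : ℝ) (r : ℕ) (f : ℤ → ℝ) :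
    ∫ ω in A1 X t r, f (tmax X t r ω) ∂ℙ =
      ∑ k ∈ Finset.range r, f ((r : ℤ) - k) * runProb X 1 t k :=
  setIntegral_eq_sum_runProb hXm hstat 1 t r (m := fun k => (r : ℤ) - k)
    (fun a b h => by simpa using h) (A1_eq_biUnion_tmax X t r)
    (fun _ hk ω h => (isGreatest_excB_of_mem_runEvent (u := fun i => X i ω) hk h).csSup_eq) f

theorem dirTheta_neg_one (Y : ℤ → Ω → Vec d) : dirTheta Y (-1) = theta Y := by
  unfold dirTheta theta Measure.real
  congr 2
  ext ω
  refine ⟨fun h j hj => ?_, fun h j hj => h _ (by omega)⟩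
  have := h (-j).toNat (by omega)
  rwa [show -1 * ((-j).toNat : ℤ) = j by omega] at this

/-- Under `DH` and `γ > 0`:
`E[t(1)^γ 1_{A₁}]/(r_n^{γ+1} w_n) → θ/(γ+1)`,
`E[(r_n − t(1))^γ 1_{A₁}]/(r_n^{γ+1} w_n) → θ/(γ+1)`, and the same with `t(N₁)`. -/
theorem stmt_3
    {d : ℕ} {Ω : Type*} [MeasureSpace Ω] [IsProbabilityMeasure (ℙ : Measure Ω)]
    (X Y : ℤ → Ω → Vec d)
    (hXm : ∀ j, Measurable (X j)) (hYm : ∀ j, Measurable (Y j))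
    (hstat : Stationary X) (htail : IsTailProcess X Y)
    (hY0 : ∀ᵐ ω ∂ℙ, 1 < ‖Y 0 ω‖)
    (x : ℕ → ℝ) (r : ℕ → ℕ) (hR : condR X x r)
    (hDH : condDH X x r)
    (γ : ℝ) (hγ : 0 < γ) :
    Tendsto (fun n : ℕ =>
        (∫ ω in A1 X (x n) (r n), (tmin X (x n) (r n) ω : ℝ) ^ γ ∂ℙ) /
          ((r n : ℝ) ^ (γ + 1) * wseq X x n)) atTop (𝓝 (theta Y / (γ + 1))) ∧
    Tendsto (fun n : ℕ =>
        (∫ ω in A1 X (x n) (r n), ((r n : ℝ) - (tmin X (x n) (r n) ω : ℝ)) ^ γ ∂ℙ) /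
          ((r n : ℝ) ^ (γ + 1) * wseq X x n)) atTop (𝓝 (theta Y / (γ + 1))) ∧
    Tendsto (fun n : ℕ =>
        (∫ ω in A1 X (x n) (r n), (tmax X (x n) (r n) ω : ℝ) ^ γ ∂ℙ) /
          ((r n : ℝ) ^ (γ + 1) * wseq X x n)) atTop (𝓝 (theta Y / (γ + 1))) ∧
    Tendsto (fun n : ℕ =>
        (∫ ω in A1 X (x n) (r n), ((r n : ℝ) - (tmax X (x n) (r n) ω : ℝ)) ^ γ ∂ℙ) /
          ((r n : ℝ) ^ (γ + 1) * wseq X x n)) atTop (𝓝 (theta Y / (γ + 1))) := by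
  obtain ⟨hx, hr, hnw, -, -⟩ := hR
  have hpos : ∀ t : ℝ, 0 < (ℙ : Measure Ω).real {ω | t < ‖X 0 ω‖} := by
    intro t
    obtain ⟨n, hn, hnt⟩ := ((hnw.eventually_gt_atTop 0).and (hx.eventually_ge_atTop t)).exists
    have hw : 0 < wseq X x n := pos_of_mul_pos_right hn (Nat.cast_nonneg n)
    exact hw.trans_le (measureReal_mono fun ω hω => lt_of_le_of_lt hnt hω)
  have hq : ∀ σ n k, |runProb X σ (x n) k / wseq X x n| ≤ 1 := fun σ n k => by
    rw [abs_of_nonneg (div_nonneg (runProb_nonneg _ _ _ _) (hpos (x n)).le : 0 ≤ _ / wseq X x n)]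
    exact div_le_one_of_le₀ (runProb_le _ _ _ _) measureReal_nonneg
  have hmain : ∀ σ : ℤ, |σ| = 1 → ∀ (a : ℕ → ℕ → ℝ) (c : ℝ),
      (∀ n, ∀ k < r n, 0 ≤ a n k) → (∀ n, ∀ k < r n, a n k ≤ 1 / (r n : ℝ)) →
      Tendsto (fun n => ∑ k ∈ Finset.range (r n), a n k) atTop (𝓝 c) →
      Tendsto (fun n => ∑ k ∈ Finset.range (r n), a n k * (runProb X σ (x n) k / wseq X x n)) atTop
        (𝓝 (c * dirTheta Y σ)) := fun σ hσ a c ha0 ha1 hac =>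
    tendsto_weighted_sum hr ha0 ha1 hac (hq σ) fun ε hε =>
      eventually_abs_runProb_div_sub_le hXm hYm hstat htail hY0 hpos hx hDH hσ hε
  have hθ : dirTheta Y 1 = theta Y := by
    have hone : Tendsto (fun n => ∑ k ∈ Finset.range (r n), 1 / (r n : ℝ)) atTop (𝓝 1) := by
      refine tendsto_const_nhds.congr' ?_
      filter_upwards [hr.eventually_gt_atTop 0] with n hn
      have : (r n : ℝ) ≠ 0 := Nat.cast_ne_zero.2 hn.ne'
      simp [this]
    have h1 := hmain 1 (by simp) (fun n _ => 1 / (r n : ℝ)) 1 (fun n k _ => by positivity)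
      (fun n k _ => le_rfl) hone
    have h2 := hmain (-1) (by simp) (fun n _ => 1 / (r n : ℝ)) 1 (fun n k _ => by positivity)
      (fun n k _ => le_rfl) hone
    rw [one_mul] at h1 h2
    rw [← dirTheta_neg_one]
    refine tendsto_nhds_unique h1 (h2.congr fun n => ?_)
    have e1 := setIntegral_tmin_eq_sum hXm hstat (x n) (r n) fun _ => 1
    have e2 := setIntegral_tmax_eq_sum hXm hstat (x n) (r n) fun _ => 1
    simp only [one_mul] at e1 e2
    rw [← Finset.mul_sum, ← Finset.mul_sum, ← Finset.sum_div, ← Finset.sum_div, ← e1, ← e2]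
  have hweights : ∀ σ : ℤ, |σ| = 1 → ∀ b : ℕ → ℕ → ℝ,
      (∀ m, ∀ k < m, 0 ≤ b m k) → (∀ m, ∀ k < m, b m k ≤ m) →
      Tendsto (fun m : ℕ => ∑ k ∈ Finset.range m, b m k ^ γ / (m : ℝ) ^ (γ + 1)) atTop
        (𝓝 (1 / (γ + 1))) →
      Tendsto (fun n => (∑ k ∈ Finset.range (r n), b (r n) k ^ γ * runProb X σ (x n) k) /
        ((r n : ℝ) ^ (γ + 1) * wseq X x n)) atTop (𝓝 (theta Y / (γ + 1))) := by
    intro σ hσ b hb0 hb1 hb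
    have hσθ : dirTheta Y σ = theta Y := by
      rcases (abs_eq one_pos.le).1 hσ with rfl | rfl
      exacts [hθ, dirTheta_neg_one Y]
    have h := hmain σ hσ (fun n k => b (r n) k ^ γ / (r n : ℝ) ^ (γ + 1)) _
      (fun n k hk => div_nonneg (Real.rpow_nonneg (hb0 _ k hk) _) (by positivity))
      (fun n k hk => rpow_div_rpow_add_one_le hγ (hb0 _ k hk) (hb1 _ k hk)
        (Nat.cast_pos.2 (pos_of_gt hk))) (hb.comp hr)
    rw [hσθ, one_div_mul_eq_div] at h
    refine h.congr fun n => ?_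
    rw [Finset.sum_div]
    exact Finset.sum_congr rfl fun k _ => div_mul_div_comm _ _ _ _
  have hcast : ∀ m : ℕ, ∀ k < m, ((m - 1 - k : ℕ) : ℝ) = (m : ℝ) - ((k : ℝ) + 1) := by
    intro m k hk
    rw [Nat.sub_sub, Nat.cast_sub (by omega)]
    push_cast
    ring
  have hle : ∀ m : ℕ, ∀ k < m, (k : ℝ) + 1 ≤ m := fun m k hk => by exact_mod_cast hk
  refine ⟨?_, ?_, ?_, ?_⟩
  · refine (hweights (-1) (by simp) (fun _ k => (k : ℝ) + 1) (fun m k _ => by positivity) hle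
      (tendsto_sum_range_succ_rpow_div γ hγ)).congr fun n => ?_
    rw [setIntegral_tmin_eq_sum hXm hstat (x n) (r n) fun i => (i : ℝ) ^ γ]
    push_cast
    rfl
  · refine (hweights (-1) (by simp) (fun m k => (m : ℝ) - ((k : ℝ) + 1))
      (fun m k hk => sub_nonneg.2 (hle m k hk)) (fun m k _ => by
        linarith [Nat.cast_nonneg (α := ℝ) k])
      ((tendsto_sum_range_rpow_div γ hγ).congr fun m => ?_)).congr fun n => ?_
    · rw [← Finset.sum_range_reflect]
      exact Finset.sum_congr rfl fun k hk => by rw [hcast m k (Finset.mem_range.1 hk)]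
    · rw [setIntegral_tmin_eq_sum hXm hstat (x n) (r n) fun i => ((r n : ℝ) - (i : ℝ)) ^ γ]
      push_cast
      rfl
  · refine (hweights 1 (by simp) (fun m k => (m : ℝ) - (k : ℝ))
      (fun m k hk => by linarith [hle m k hk]) (fun m k _ => by
        linarith [Nat.cast_nonneg (α := ℝ) k])
      ((tendsto_sum_range_succ_rpow_div γ hγ).congr fun m => ?_)).congr fun n => ?_
    · rw [← Finset.sum_range_reflect]
      refine Finset.sum_congr rfl fun k hk => ?_
      rw [hcast m k (Finset.mem_range.1 hk)]
      congr 2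
      ring
    · rw [setIntegral_tmax_eq_sum hXm hstat (x n) (r n) fun i => (i : ℝ) ^ γ]
      push_cast
      rfl
  · refine (hweights 1 (by simp) (fun _ k => (k : ℝ)) (fun m k _ => by positivity)
      (fun m k hk => by linarith [hle m k hk])
      (tendsto_sum_range_rpow_div γ hγ)).congr fun n => ?_
    rw [setIntegral_tmax_eq_sum hXm hstat (x n) (r n) fun i => ((r n : ℝ) - (i : ℝ)) ^ γ]
    simp only [Int.cast_sub, Int.cast_natCast, sub_sub_cancel]

end ClusterPaper
end
end
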